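/- arXiv:2211.14116 — 3 statements merged into one kernel-verified Lean document; each statement's English description precedes it below -/
import Mathlib

section
/- Let X be an infinite-dimensional complex Banach space and A, B bounded linear operators on X. The following are equivalent: (i) K(AT + TA) = K(BT + TB) for every T ∈ B(X); (ii) K(AF + FA) = K(BF + FB) for every rank-at-most-one operator F; (iii) B = λA for some nonzero λ ∈ ℂ (or A = B = 0). -/
def analyticCore {X : Type*} [NormedAddCommGroup X] [NormedSpace ℂ X]
    (T : X →L[ℂ] X) : Set X :=
  {x | ∃ δ : ℝ, 0 < δ ∧ ∃ u : ℕ → X, u 0 = x ∧ (∀ n, T (u (n + 1)) = u n) ∧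
    ∀ n, ‖u n‖ ≤ δ ^ n * ‖x‖}

section Helpers

variable {X : Type*} [NormedAddCommGroup X] [NormedSpace ℂ X]

theorem acj_exists_functional {n : ℕ} {v : Fin n → X} (hv : LinearIndependent ℂ v)
    (c : Fin n → ℂ) : ∃ f : X →L[ℂ] ℂ, ∀ i, f (v i) = c i := by
  have hinj : Function.Injective (Fintype.linearCombination ℂ v) :=
    by
    rw [injective_iff_map_eq_zero]
    intro g hg
    rw [Fintype.linearCombination_apply] at hg
    exact funext (Fintype.linearIndependent_iff.mp hv g hg)
  obtain ⟨f, hf⟩ := (SeparatingDual.dualMap_surjective_iff (R := ℂ)).mpr hinj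
    (Fintype.linearCombination ℂ c)
  refine ⟨f, fun i => ?_⟩
  have := LinearMap.congr_fun hf (Pi.single i 1)
  simpa using this

theorem acj_pair {x y : X} (h : ¬ ∃ c : ℂ, y = c • x) (hx : x ≠ 0) (α β : ℂ)
    (e : α • x + β • y = 0) : α = 0 ∧ β = 0 := by
  have hb : β = 0 := by
    by_contra hb
    apply h
    refine ⟨-(β⁻¹ * α), ?_⟩
    have : β⁻¹ • (α • x + β • y) = 0 := by rw [e, smul_zero]
    rw [smul_add, smul_smul, smul_smul, inv_mul_cancel₀ hb] at this
    linear_combination (norm := module) this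
  subst hb
  simp only [zero_smul, add_zero, smul_eq_zero] at e
  exact ⟨e.resolve_right hx, rfl⟩

theorem acj_core_sub (R : X →L[ℂ] X) {x : X} (hx : x ∈ analyticCore R) :
    ∃ z, R z = x ∧ ∃ z', R (R z') = x := by
  obtain ⟨δ, -, u, h0, hu, -⟩ := hx
  refine ⟨u 1, by rw [hu 0, h0], u 2, by rw [hu 1, hu 0, h0]⟩

theorem acj_core_smul_sub (R : X →L[ℂ] X) {l : ℂ} (hl : l ≠ 0) :
    analyticCore R ⊆ analyticCore (l • R) := by
  rintro x ⟨δ, hδ, u, h0, hu, hb⟩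
  refine ⟨‖l‖⁻¹ * δ, by positivity, fun n => (l⁻¹) ^ n • u n, by simp [h0], fun n => ?_,
    fun n => ?_⟩
  · simp only [_root_.smul_apply, map_smul, hu, smul_smul]
    congr 1
    rw [pow_succ]
    field_simp
  · rw [norm_smul, norm_pow, norm_inv, mul_pow, mul_assoc]
    exact mul_le_mul_of_nonneg_left (hb n) (by positivity)

theorem acj_core_smul (R : X →L[ℂ] X) {l : ℂ} (hl : l ≠ 0) :
    analyticCore (l • R) = analyticCore R := by
  apply Set.Subset.antisymm _ (acj_core_smul_sub R hl)
  have := acj_core_smul_sub (l • R) (inv_ne_zero hl)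
  rwa [smul_smul, inv_mul_cancel₀ hl, one_smul] at this

theorem acj_core_eig (R : X →L[ℂ] X) {l : ℂ} (hl : l ≠ 0) {v : X} (h : R v = l • v) :
    v ∈ analyticCore R := by
  refine ⟨‖l‖⁻¹, by positivity, fun n => (l⁻¹) ^ n • v, by simp, fun n => ?_, fun n => ?_⟩
  · simp only [map_smul, h, smul_smul]
    congr 1
    rw [pow_succ]
    field_simp
  · rw [norm_smul, norm_pow, norm_inv]

theorem acj_core_jordan (R : X →L[ℂ] X) {x y : X} (g : ℂ) (hx : R x = x)
    (hy : R y = y + g • x) : y ∈ analyticCore R := by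
  by_cases hy0 : y = 0
  · refine ⟨1, one_pos, fun _ => 0, by simp [hy0], by simp, by simp⟩
  have hyn : 0 < ‖y‖ := norm_pos_iff.mpr hy0
  refine ⟨1 + ‖g • x‖ / ‖y‖, by positivity, fun n => y - (n : ℂ) • (g • x), by simp,
    fun n => ?_, fun n => ?_⟩
  · simp only [map_sub, map_smul, hx, hy]
    push_cast
    module
  · have h1 := one_add_mul_le_pow (a := ‖g • x‖ / ‖y‖)
      (le_trans (by norm_num) (by positivity : (0:ℝ) ≤ ‖g • x‖ / ‖y‖)) n
    calc ‖y - (n : ℂ) • (g • x)‖ ≤ ‖y‖ + ‖(n : ℂ) • (g • x)‖ := norm_sub_le _ _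
      _ = ‖y‖ + n * ‖g • x‖ := by rw [norm_smul (n : ℂ)]; simp
      _ = (1 + n * (‖g • x‖ / ‖y‖)) * ‖y‖ := by field_simp
      _ ≤ _ := mul_le_mul_of_nonneg_right h1 hyn.le

theorem acj_outside {N S : Submodule ℂ X} (hN : ¬ FiniteDimensional ℂ N)
    [FiniteDimensional ℂ S] : ∃ n ∈ N, n ∉ S := by
  by_contra! h
  exact hN (Submodule.finiteDimensional_of_le (S₂ := S) h)

/-- The range of `C` lies in `span {x, A x}`. -/
theorem acj_range (A C : X →L[ℂ] X) (x : X) (hx : ¬ ∃ c : ℂ, A x = c • x)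
    (hC : ∀ y, ∃ a b : ℂ, C y = a • y + b • A y) (hCx : C x = 0) (y : X) :
    C y ∈ Submodule.span ℂ (Set.range ![x, A x]) := by
  have hx0 : x ≠ 0 := by
    rintro rfl
    exact hx ⟨0, by simp⟩
  have hind : LinearIndependent ℂ ![x, A x] :=
    LinearIndependent.pair_iff.mpr fun α β e => acj_pair hx hx0 α β e
  by_contra hy
  have h3 : LinearIndependent ℂ ![C y, x, A x] := linearIndependent_finCons.mpr ⟨hind, hy⟩
  have hopen : IsOpen {v : Fin 3 → X | LinearIndependent ℂ v} :=
    isOpen_setOfPred_linearIndependent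
  let φ : ℂ → Fin 3 → X := fun s => ![C y, x + s • y, A x + s • A y]
  have hφ : Continuous φ := by
    refine continuous_pi fun i => ?_
    fin_cases i <;> simp [φ] <;> fun_prop
  have hmem : φ ⁻¹' {v : Fin 3 → X | LinearIndependent ℂ v} ∈ nhds (0 : ℂ) :=
    (hopen.preimage hφ).mem_nhds (by simpa [φ] using h3)
  have hmem' := mem_nhdsWithin_of_mem_nhds (t := {(0 : ℂ)}ᶜ) hmem
  obtain ⟨s, hs1, hs0⟩ :=
    (Filter.nonempty_of_mem (Filter.inter_mem hmem' self_mem_nhdsWithin))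
  have hs1 : LinearIndependent ℂ ![C y, x + s • y, A x + s • A y] := hs1
  have hs0 : s ≠ 0 := hs0
  obtain ⟨a, b, hab⟩ := hC (x + s • y)
  rw [map_add, map_smul, hCx, map_add, map_smul, zero_add] at hab
  have := Fintype.linearIndependent_iff.mp hs1 ![s, -a, -b] (by
    simp only [Fin.sum_univ_three, Matrix.cons_val]
    linear_combination (norm := module) hab) 0
  exact hs0 (by simpa using this)

theorem acj_zero (hX : ¬ FiniteDimensional ℂ X) (A C : X →L[ℂ] X) (x : X)
    (hx : ¬ ∃ c : ℂ, A x = c • x)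
    (hC : ∀ y, ∃ a b : ℂ, C y = a • y + b • A y) (hCx : C x = 0) : C = 0 := by
  by_contra hC0
  obtain ⟨y0, hy0⟩ : ∃ y, C y ≠ 0 := by
    by_contra! h
    exact hC0 (by ext z; simpa using h z)
  set w := C y0 with hw
  have hx0 : x ≠ 0 := by
    rintro rfl
    exact hx ⟨0, by simp⟩
  let N : Submodule ℂ X := LinearMap.ker (C : X →ₗ[ℂ] X)
  have hN : ¬ FiniteDimensional ℂ N := by
    intro hfin
    have hr : LinearMap.range (C : X →ₗ[ℂ] X) ≤ Submodule.span ℂ (Set.range ![x, A x]) := by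
      rintro _ ⟨y, rfl⟩
      exact acj_range A C x hx hC hCx y
    have hfr : FiniteDimensional ℂ (LinearMap.range (C : X →ₗ[ℂ] X)) := by
      haveI : FiniteDimensional ℂ (Submodule.span ℂ (Set.range ![x, A x])) :=
        FiniteDimensional.span_of_finite ℂ (Set.finite_range _)
      exact Submodule.finiteDimensional_of_le hr
    haveI : FiniteDimensional ℂ (X ⧸ N) :=
      Module.Finite.equiv (LinearMap.quotKerEquivRange (C : X →ₗ[ℂ] X)).symm
    exact hX (Module.Finite.of_submodule_quotient N)
  have hNm : ∀ n ∈ N, C n = 0 := fun n hn => hn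
  -- a suitable non-eigenvector in the kernel
  obtain ⟨n, hCn, hn, hwn⟩ : ∃ n, C n = 0 ∧ (¬ ∃ c : ℂ, A n = c • n) ∧
      ¬ ∃ c : ℂ, w = c • n := by
    by_cases hwx : ∃ c : ℂ, w = c • x
    · obtain ⟨k, hk⟩ := hwx
      have hk0 : k ≠ 0 := by
        rintro rfl
        exact hy0 (by simpa using hk)
      obtain ⟨m, hmN, hm⟩ := acj_outside hN (S := Submodule.span ℂ {x})
      have hCm := hNm m hmN
      have hmx : ¬ ∃ c : ℂ, m = c • x := fun ⟨c, hc⟩ =>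
        hm (Submodule.mem_span_singleton.mpr ⟨c, hc.symm⟩)
      have key : ∀ s t : ℂ, t ≠ 0 → ¬ ∃ c : ℂ, w = c • (s • x + t • m) := by
        rintro s t ht ⟨c, hc⟩
        have := acj_pair hmx hx0 (k - c * s) (-(c * t)) (by
          linear_combination (norm := module) hc - hk)
        have hc0 : c = 0 := by
          have := this.2
          simpa [ht] using this
        exact hy0 (by rw [hc, hc0, zero_smul])
      by_contra! hcon
      have hcon' : ∀ s t : ℂ, t ≠ 0 → ∃ c : ℂ, A (s • x + t • m) = c • (s • x + t • m) := by
        intro s t ht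
        by_contra h
        obtain ⟨c, hc⟩ := hcon (s • x + t • m) (by simp [hCx, hCm]) (by simpa using h)
        exact key s t ht ⟨c, hc⟩
      obtain ⟨c0, h0⟩ := hcon' 0 1 one_ne_zero
      obtain ⟨c1, h1⟩ := hcon' 1 1 one_ne_zero
      obtain ⟨c2, h2⟩ := hcon' 1 (-1) (by norm_num)
      simp only [map_add, map_smul] at h0 h1 h2
      have h3 := acj_pair hmx hx0 (c1 - c2) (c1 - c0 + c2 - c0) (by
        linear_combination (norm := module) h2 - h1 + (2:ℂ) • h0)
      have h4 : c1 = c0 := by linear_combination (h3.1 + h3.2) / 2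
      subst h4
      exact hx ⟨c1, by linear_combination (norm := module) h1 - h0⟩
    · exact ⟨x, hCx, hx, hwx⟩
  have hn0 : n ≠ 0 := by
    rintro rfl
    exact hn ⟨0, by simp⟩
  -- a suitable y
  obtain ⟨y, hCy, hy⟩ : ∃ y, C y = w ∧ y ∉ Submodule.span ℂ {n, w} := by
    haveI : FiniteDimensional ℂ (Submodule.span ℂ {n, w}) :=
      FiniteDimensional.span_of_finite ℂ (by simp)
    by_cases h : y0 ∈ Submodule.span ℂ {n, w}
    · obtain ⟨m, hmN, hm⟩ := acj_outside hN (S := Submodule.span ℂ {n, w})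
      refine ⟨y0 + m, by simp [hNm m hmN, hw], fun h' => hm ?_⟩
      simpa using Submodule.sub_mem _ h' h
    · exact ⟨y0, rfl, h⟩
  have hind : ∀ α β γ : ℂ, α • n + β • y + γ • w = 0 → α = 0 ∧ β = 0 ∧ γ = 0 := by
    intro α β γ e
    have hb : β = 0 := by
      by_contra hb
      apply hy
      rw [Submodule.mem_span_pair]
      refine ⟨-(β⁻¹ * α), -(β⁻¹ * γ), ?_⟩
      have : β⁻¹ • (α • n + β • y + γ • w) = 0 := by rw [e, smul_zero]
      rw [smul_add, smul_add, smul_smul, smul_smul, inv_mul_cancel₀ hb, smul_smul] at this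
      linear_combination (norm := module) -this
    subst hb
    have := acj_pair hwn hn0 α γ (by simpa using e)
    exact ⟨this.1, rfl, this.2⟩
  have hA : ∀ s : ℂ, ∃ c d : ℂ, A y + s • A n = c • (y + s • n) + d • w := by
    intro s
    obtain ⟨a, b, hab⟩ := hC (y + s • n)
    simp only [map_add, map_smul, hCy, hCn, smul_zero, add_zero] at hab
    have hb : b ≠ 0 := by
      rintro rfl
      have := hind (-(a * s)) (-a) 1 (by linear_combination (norm := module) hab)
      exact one_ne_zero this.2.2
    refine ⟨-(b⁻¹ * a), b⁻¹, ?_⟩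
    have h2 : b⁻¹ • w = b⁻¹ • (a • (y + s • n)) + (A y + s • A n) := by
      rw [hab, smul_add, smul_smul b⁻¹ b, inv_mul_cancel₀ hb, one_smul]
    linear_combination (norm := module) -h2
  obtain ⟨c0, d0, h0⟩ := hA 0
  obtain ⟨c1, d1, h1⟩ := hA 1
  obtain ⟨c2, d2, h2⟩ := hA (-1)
  have h3 := hind (c1 - c2) (c1 - c0 + c2 - c0) (d1 - d0 + d2 - d0) (by
    linear_combination (norm := module) (2:ℂ) • h0 - h1 - h2)
  have h4 : c1 = c0 := by linear_combination (h3.1 + h3.2.1) / 2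
  subst h4
  have hAn : A n = c1 • n + (d1 - d0) • w := by
    linear_combination (norm := module) h1 - h0
  have he : d1 - d0 ≠ 0 := by
    intro he
    exact hn ⟨c1, by rw [hAn, he]; simp⟩
  set s : ℂ := -d0 / (d1 - d0) with hs
  have hs' : d0 + s * (d1 - d0) = 0 := by rw [hs]; field_simp; ring
  have hev : A y + s • A n = c1 • (y + s • n) := by
    have : (d0 + s * (d1 - d0)) • w = 0 := by rw [hs', zero_smul]
    linear_combination (norm := module) h0 + s • hAn + this
  obtain ⟨a, b, hab⟩ := hC (y + s • n)
  simp only [map_add, map_smul, hCy, hCn, smul_zero, add_zero, hev] at hab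
  have := hind (-((a + b * c1) * s)) (-(a + b * c1)) 1 (by
    linear_combination (norm := module) hab)
  exact one_ne_zero this.2.2

theorem acj_local (hX : ¬ FiniteDimensional ℂ X) (A B : X →L[ℂ] X) (x : X)
    (hx : ¬ ∃ c : ℂ, A x = c • x)
    (hB : ∀ y, ∃ a b : ℂ, B y = a • y + b • A y) :
    ∃ a b : ℂ, ∀ y, B y = a • y + b • A y := by
  obtain ⟨a, b, hab⟩ := hB x
  refine ⟨a, b, fun y => ?_⟩
  have := acj_zero hX A (B - a • ContinuousLinearMap.id ℂ X - b • A) x hx (fun y => by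
    obtain ⟨a', b', h⟩ := hB y
    refine ⟨a' - a, b' - b, ?_⟩
    simp [h]
    module) (by simp [hab])
  have h := congrArg (fun T : X →L[ℂ] X => T y) this
  simp at h
  linear_combination (norm := module) h

theorem acj_scalar (A : X →L[ℂ] X) (h : ∀ x, ∃ c : ℂ, A x = c • x) :
    ∃ c : ℂ, ∀ x, A x = c • x := by
  obtain ⟨c, hc⟩ := LinearMap.exists_eq_smul_id_of_forall_notLinearIndependent
    (f := (A : X →ₗ[ℂ] X)) (fun v hv => by
      obtain ⟨c, hc⟩ := h v
      have := LinearIndependent.pair_iff.mp hv c (-1) (by simp [hc])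
      simpa using this.2)
  exact ⟨c, fun x => by simpa using LinearMap.congr_fun hc x⟩

/-- The pointwise relation between `A` and `B`. -/
theorem acj_pointwise (A B : X →L[ℂ] X)
    (h : ∀ (x : X) (f : X →L[ℂ] ℂ),
        analyticCore (A * f.smulRight x + f.smulRight x * A) =
          analyticCore (B * f.smulRight x + f.smulRight x * B)) (x : X) :
    ∃ a b : ℂ, A x = a • x + b • B x := by
  by_cases hx : ∃ c : ℂ, A x = c • x
  · obtain ⟨c, hc⟩ := hx
    exact ⟨c, 0, by simp [hc]⟩
  have hx0 : x ≠ 0 := by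
    rintro rfl
    exact hx ⟨0, by simp⟩
  have hind : LinearIndependent ℂ ![x, A x] :=
    LinearIndependent.pair_iff.mpr fun α β e => acj_pair hx hx0 α β e
  obtain ⟨f, hf⟩ := acj_exists_functional hind ![0, 1]
  have hf0 : f x = 0 := by simpa using hf 0
  have hf1 : f (A x) = 1 := by simpa using hf 1
  have hmem : A x ∈ analyticCore (A * f.smulRight x + f.smulRight x * A) := by
    apply acj_core_jordan _ (x := x) (f (A (A x))) <;> simp [hf0, hf1]
  rw [h] at hmem
  obtain ⟨z, hz, -⟩ := acj_core_sub _ hmem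
  refine ⟨f (B z), f z, ?_⟩
  rw [← hz]
  simp
  abel

theorem acj_key (A B : X →L[ℂ] X) (x : X) (f : X →L[ℂ] ℂ) (t : ℂ) (ht : t ≠ 0) (τ : ℂ)
    (h : analyticCore (A * f.smulRight x + f.smulRight x * A) =
          analyticCore (B * f.smulRight x + f.smulRight x * B))
    (hfx : f x = 1) (hA1 : f (A x) = t) (hA2 : f (A (A x)) = t ^ 2)
    (hB1 : f (B x) = τ) (hB2 : f (B (B x)) = τ ^ 2) :
    ∃ k : ℂ, t • x + A x = k • (τ • x + B x) := by
  have hmem : t • x + A x ∈ analyticCore (A * f.smulRight x + f.smulRight x * A) := by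
    apply acj_core_eig _ (l := 2 * t) (by simpa using ht)
    simp [hfx, hA1, hA2]
    module
  rw [h] at hmem
  obtain ⟨-, -, z, hz⟩ := acj_core_sub _ hmem
  refine ⟨f z * τ + f (B z), ?_⟩
  rw [← hz]
  simp [hfx, hB1, hB2]
  module

theorem acj_functional (A : X →L[ℂ] X) (x : X) (hx : ¬ ∃ c : ℂ, A x = c • x) :
    ∃ (f : X →L[ℂ] ℂ) (t : ℂ), f x = 1 ∧ f (A x) = t ∧ f (A (A x)) = t ^ 2 := by
  have hx0 : x ≠ 0 := by
    rintro rfl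
    exact hx ⟨0, by simp⟩
  have hind : LinearIndependent ℂ ![x, A x] :=
    LinearIndependent.pair_iff.mpr fun α β e => acj_pair hx hx0 α β e
  by_cases hd : A (A x) ∈ Submodule.span ℂ (Set.range ![x, A x])
  · have hd' : A (A x) ∈ Submodule.span ℂ {x, A x} := by
      simpa [Set.pair_comm] using hd
    obtain ⟨q, p, hpq⟩ := Submodule.mem_span_pair.mp hd'
    obtain ⟨s, hs⟩ := IsAlgClosed.exists_eq_mul_self (discrim (1 : ℂ) (-p) (-q))
    obtain ⟨t, ht⟩ := exists_quadratic_eq_zero one_ne_zero ⟨s, hs⟩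
    obtain ⟨f, hf⟩ := acj_exists_functional hind ![1, t]
    have hf0 : f x = 1 := by simpa using hf 0
    have hf1 : f (A x) = t := by simpa using hf 1
    refine ⟨f, t, hf0, hf1, ?_⟩
    rw [← hpq]
    simp only [map_add, map_smul, hf0, hf1, smul_eq_mul]
    linear_combination -ht
  · have h3 : LinearIndependent ℂ ![A (A x), x, A x] :=
      linearIndependent_finCons.mpr ⟨hind, hd⟩
    obtain ⟨f, hf⟩ := acj_exists_functional h3 ![0, 1, 0]
    have hf0 : f (A (A x)) = 0 := by simpa using hf 0
    have hf1 : f x = 1 := by simpa using hf 1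
    have hf2 : f (A x) = 0 := by simpa using hf 2
    exact ⟨f, 0, hf1, hf2, by simp [hf0]⟩

theorem acj_main (hX : ¬ FiniteDimensional ℂ X) (A B : X →L[ℂ] X)
    (h : ∀ (x : X) (f : X →L[ℂ] ℂ),
        analyticCore (A * f.smulRight x + f.smulRight x * A) =
          analyticCore (B * f.smulRight x + f.smulRight x * B)) :
    ∃ lam : ℂ, lam ≠ 0 ∧ B = lam • A := by
  have hAB := acj_pointwise A B h
  have hBA := acj_pointwise B A (fun x f => (h x f).symm)
  by_cases hsc : ∀ x, ∃ c : ℂ, A x = c • x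
  · obtain ⟨α, hα⟩ := acj_scalar A hsc
    obtain ⟨β, hβ⟩ := acj_scalar B (fun x => by
      obtain ⟨a, b, hab⟩ := hBA x
      exact ⟨a + b * α, by rw [hab, hα]; module⟩)
    obtain ⟨x, hx⟩ : ∃ x : X, x ≠ 0 := by
      by_contra! hz
      haveI : Subsingleton X := ⟨fun a b => by rw [hz a, hz b]⟩
      exact hX inferInstance
    obtain ⟨f, hf⟩ := SeparatingDual.exists_eq_one (R := ℂ) hx
    have aux : ∀ (P Q : X →L[ℂ] X) (p q : ℂ), (∀ x, P x = p • x) → (∀ x, Q x = q • x) →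
        analyticCore (P * f.smulRight x + f.smulRight x * P) =
          analyticCore (Q * f.smulRight x + f.smulRight x * Q) → p ≠ 0 → q ≠ 0 := by
      intro P Q p q hP hQ hPQ hp hq
      have hmem : x ∈ analyticCore (P * f.smulRight x + f.smulRight x * P) := by
        apply acj_core_eig _ (l := 2 * p) (by simpa using hp)
        simp [hP, hf]
        module
      rw [hPQ] at hmem
      obtain ⟨z, hz, -⟩ := acj_core_sub _ hmem
      simp [hQ, hq] at hz
      exact hx hz.symm
    by_cases hα0 : α = 0
    · have hβ0 : β = 0 := by
        by_contra hb
        exact aux B A β α hβ hα (h x f).symm hb hα0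
      exact ⟨1, one_ne_zero, by ext z; simp [hα, hβ, hα0, hβ0]⟩
    · have hb := aux A B α β hα hβ (h x f) hα0
      refine ⟨β / α, div_ne_zero hb hα0, ?_⟩
      ext z
      simp only [_root_.smul_apply, hα, hβ, smul_smul]
      congr 1
      field_simp
  · push Not at hsc
    obtain ⟨x, hx⟩ := hsc
    have hx : ¬ ∃ c : ℂ, A x = c • x := by simpa using hx
    have hx0 : x ≠ 0 := by
      rintro rfl
      exact hx ⟨0, by simp⟩
    obtain ⟨a, b, hB⟩ := acj_local hX A B x hx hBA
    have hb : b ≠ 0 := by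
      rintro rfl
      obtain ⟨p, q, hpq⟩ := hAB x
      exact hx ⟨p + q * a, by rw [hpq, hB]; module⟩
    obtain ⟨f, t, hf0, hf1, hf2⟩ := acj_functional A x hx
    have hB1 : f (B x) = a + b * t := by simp [hB, hf0, hf1]
    have hB2 : f (B (B x)) = (a + b * t) ^ 2 := by
      simp only [hB, map_add, map_smul, hf0, hf1, hf2, smul_eq_mul]
      ring
    have ha : a = 0 := by
      by_cases ht : t = 0
      · subst ht
        by_contra ha
        obtain ⟨k, hk⟩ := acj_key B A x f (a + b * 0) (by simpa using ha) 0 (h x f).symm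
          hf0 hB1 hB2 hf1 hf2
        rw [hB] at hk
        have := acj_pair hx hx0 (2 * a) (b - k) (by linear_combination (norm := module) hk)
        exact ha (by simpa using this.1)
      · obtain ⟨k, hk⟩ := acj_key A B x f t ht (a + b * t) (h x f) hf0 hf1 hf2 hB1 hB2
        rw [hB] at hk
        have := acj_pair hx hx0 (t - k * (2 * a + b * t)) (1 - k * b) (by
          linear_combination (norm := module) hk)
        have hk0 : k ≠ 0 := by
          rintro rfl
          simpa using this.2
        have h2 : k * a = 0 := by
          linear_combination (-1 / 2) * this.1 + t / 2 * this.2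
        exact (mul_eq_zero.mp h2).resolve_left hk0
    refine ⟨b, hb, ?_⟩
    ext z
    simp [hB, ha]

end Helpers

theorem analyticCore_jordan_tfae {X : Type*} [NormedAddCommGroup X]
    [NormedSpace ℂ X] [CompleteSpace X] (hX : ¬ FiniteDimensional ℂ X)
    (A B : X →L[ℂ] X) :
    ((∀ T : X →L[ℂ] X,
        analyticCore (A * T + T * A) = analyticCore (B * T + T * B)) ↔
      (∃ lam : ℂ, lam ≠ 0 ∧ B = lam • A)) ∧
    ((∀ (x : X) (f : X →L[ℂ] ℂ),
        analyticCore (A * f.smulRight x + f.smulRight x * A) =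
          analyticCore (B * f.smulRight x + f.smulRight x * B)) ↔
      (∃ lam : ℂ, lam ≠ 0 ∧ B = lam • A)) := by
  have h31 : (∃ lam : ℂ, lam ≠ 0 ∧ B = lam • A) → ∀ T : X →L[ℂ] X,
      analyticCore (A * T + T * A) = analyticCore (B * T + T * B) := by
    rintro ⟨l, hl, rfl⟩ T
    rw [smul_mul_assoc, mul_smul_comm, ← smul_add, acj_core_smul _ hl]
  exact ⟨⟨fun h => acj_main hX A B fun x f => h _, h31⟩,
    ⟨acj_main hX A B, fun h x f => h31 h _⟩⟩
end

section
/- Let X be an infinite-dimensional complex Banach space and φ : B(X) → B(X) a surjective map. Then K(φ(T)φ(S) + φ(S)φ(T)) = K(TS + ST) holds for all T, S ∈ B(X) if and only if there exists a map γ : B(X) → ℂ \ {0} such that φ(T) = γ(T)·T for all T ∈ B(X). -/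
section aux
variable {X : Type*} [NormedAddCommGroup X] [NormedSpace ℂ X]

/-- Membership in the core from a bound with a constant. -/
theorem core_mk (R : X →L[ℂ] X) (x : X) (C δ : ℝ) (hδ : 0 < δ) (u : ℕ → X) (h0 : u 0 = x)
    (hR : ∀ n, R (u (n + 1)) = u n) (hb : ∀ n, ‖u n‖ ≤ C * δ ^ n) : x ∈ analyticCore R := by
  by_cases hx : x = 0
  · subst hx
    exact ⟨1, one_pos, fun _ => 0, rfl, by simp, by simp⟩
  · have hx' : 0 < ‖x‖ := norm_pos_iff.2 hx
    have hm : 1 ≤ max 1 (C / ‖x‖) := le_max_left _ _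
    refine ⟨δ * max 1 (C / ‖x‖), by positivity, u, h0, hR, ?_⟩
    intro n
    rcases n with _ | n
    · simp [h0]
    · refine (hb (n+1)).trans ?_
      rw [mul_pow]
      have h1 : C / ‖x‖ ≤ (max 1 (C / ‖x‖)) ^ (n+1) :=
        (le_max_right 1 _).trans (le_self_pow₀ hm (by omega))
      have h2 : C ≤ (max 1 (C / ‖x‖)) ^ (n+1) * ‖x‖ := by
        rwa [div_le_iff₀ hx'] at h1
      have h3 : 0 < δ ^ (n+1) := by positivity
      nlinarith [mul_le_mul_of_nonneg_right h2 h3.le]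

theorem core_zero (R : X →L[ℂ] X) : (0 : X) ∈ analyticCore R :=
  core_mk R 0 0 1 one_pos (fun _ => 0) rfl (by simp) (by simp)

theorem core_pre (R : X →L[ℂ] X) {x : X} (hx : x ∈ analyticCore R) :
    ∃ y ∈ analyticCore R, R y = x := by
  obtain ⟨δ, hδ, u, h0, hR, hb⟩ := hx
  refine ⟨u 1, core_mk R _ (δ * ‖x‖) δ hδ (fun n => u (n+1)) rfl (fun n => hR _) ?_, ?_⟩
  · intro n
    have := hb (n+1)
    rw [pow_succ] at this
    linarith
  · rw [← h0]; exact hR 0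

theorem core_smul_sub (R : X →L[ℂ] X) (c : ℂ) (hc : c ≠ 0) :
    analyticCore R ⊆ analyticCore (c • R) := by
  rintro x ⟨δ, hδ, u, h0, hR, hb⟩
  have hc' : 0 < ‖c‖ := norm_pos_iff.2 hc
  refine core_mk _ x ‖x‖ (‖c‖⁻¹ * δ) (by positivity) (fun n => (c⁻¹) ^ n • u n) (by simp [h0]) ?_ ?_
  · intro n
    simp only [smul_apply, map_smul, hR, smul_smul]
    congr 1
    have := inv_mul_cancel₀ hc
    rw [pow_succ]
    linear_combination (c⁻¹ ^ n) * this
  · intro n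
    rw [norm_smul, norm_pow, norm_inv, mul_pow]
    have := hb n
    have h3 : 0 ≤ ‖c‖⁻¹ ^ n := by positivity
    nlinarith [mul_le_mul_of_nonneg_left this h3]

theorem core_smul (R : X →L[ℂ] X) (c : ℂ) (hc : c ≠ 0) :
    analyticCore (c • R) = analyticCore R := by
  apply subset_antisymm _ (core_smul_sub R c hc)
  have := core_smul_sub (c • R) c⁻¹ (inv_ne_zero hc)
  rwa [smul_smul, inv_mul_cancel₀ hc, one_smul] at this

theorem core_sq (R : X →L[ℂ] X) : analyticCore (R * R) = analyticCore R := by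
  ext x
  constructor
  · rintro ⟨δ, hδ, u, h0, hR, hb⟩
    -- use the square-root of a large constant
    set d := max δ 1 with hd
    have hd1 : 1 ≤ d := le_max_right _ _
    have hbd : ∀ n, ‖u n‖ ≤ d ^ n * ‖x‖ := fun n => (hb n).trans (by gcongr; exact le_max_left _ _)
    refine core_mk R x ((1 + ‖R‖ * d) * ‖x‖) d (by linarith)
      (fun n => if n % 2 = 0 then u (n / 2) else R (u (n / 2 + 1))) (by simp [h0]) ?_ ?_
    · intro n
      rcases Nat.mod_two_eq_zero_or_one n with h | h
      · have h1 : (n + 1) % 2 = 1 := by omega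
        have h2 : (n + 1) / 2 = n / 2 := by omega
        simp only [h1, h2, h]
        simpa using hR (n / 2)
      · have h1 : (n + 1) % 2 = 0 := by omega
        have h2 : (n + 1) / 2 = n / 2 + 1 := by omega
        simp [h1, h2, h]
    · intro n
      have hle : d ^ (n / 2) ≤ d ^ n := pow_le_pow_right₀ hd1 (by omega)
      have hR0 := norm_nonneg R
      have hx0 := norm_nonneg x
      have hp : 0 ≤ ‖R‖ * d := by positivity
      have hp2 : 0 < d ^ n := by positivity
      have key : d ^ (n/2) * ‖x‖ ≤ d ^ n * ‖x‖ := by gcongr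
      split_ifs
      · refine (hbd _).trans (key.trans ?_)
        nlinarith [mul_nonneg hp (mul_nonneg hp2.le hx0)]
      · have h5 := R.le_opNorm (u (n / 2 + 1))
        have h6 := mul_le_mul_of_nonneg_left (hbd (n/2+1)) hR0
        have h7 := mul_le_mul_of_nonneg_left key hp
        rw [pow_succ] at h6
        nlinarith [mul_nonneg hp2.le hx0]
  · rintro ⟨δ, hδ, u, h0, hR, hb⟩
    refine core_mk _ x ‖x‖ (δ ^ 2) (by positivity) (fun n => u (2 * n)) (by simp [h0]) ?_ ?_
    · intro n
      change R (R _) = _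
      rw [show 2 * (n + 1) = 2 * n + 1 + 1 by ring, hR, hR]
    · intro n
      have := hb (2 * n)
      rw [pow_mul] at this
      linarith

theorem core_eigen (R : X →L[ℂ] X) (w : X) (μ : ℂ) (hμ : μ ≠ 0) (h : R w = μ • w) :
    w ∈ analyticCore R := by
  have : 0 < ‖μ‖ := norm_pos_iff.2 hμ
  refine core_mk R w ‖w‖ (‖μ‖⁻¹) (by positivity) (fun n => μ⁻¹ ^ n • w) (by simp) ?_ ?_
  · intro n
    simp only [map_smul, h, smul_smul]
    congr 1
    have := inv_mul_cancel₀ hμ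
    rw [pow_succ]
    linear_combination (μ⁻¹ ^ n) * this
  · intro n
    simp [norm_smul, mul_comm]

theorem core_invariant (R : X →L[ℂ] X) (W : Submodule ℂ X) [CompleteSpace W]
    (h : ∀ w ∈ W, R w ∈ W) (hs : ∀ w ∈ W, ∃ v ∈ W, R v = w) : (W : Set X) ⊆ analyticCore R := by
  intro w hw
  let Q : W →L[ℂ] W := (R.comp W.subtypeL).codRestrict W (fun v => h v v.2)
  have hQ : Function.Surjective Q := by
    rintro ⟨v, hv⟩
    obtain ⟨z, hz, hzv⟩ := hs v hv
    exact ⟨⟨z, hz⟩, Subtype.ext hzv⟩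
  obtain ⟨C, hC, hpre⟩ := Q.exists_preimage_norm_le hQ
  choose g hg hgn using hpre
  refine core_mk R w ‖w‖ C hC (fun n => ((g^[n] ⟨w, hw⟩ : W) : X)) (by simp) ?_ ?_
  · intro n
    rw [Function.iterate_succ_apply']
    exact congrArg Subtype.val (hg (g^[n] ⟨w, hw⟩))
  · intro n
    induction n with
    | zero => simp
    | succ n ih =>
      rw [Function.iterate_succ_apply']
      refine (hgn _).trans ?_
      rw [pow_succ]
      have : ‖(g^[n] ⟨w, hw⟩ : W)‖ ≤ ‖w‖ * C ^ n := ih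
      nlinarith

theorem core_surj [CompleteSpace X] (R : X →L[ℂ] X) (hs : Function.Surjective R) :
    analyticCore R = Set.univ := by
  have : CompleteSpace (⊤ : Submodule ℂ X) :=
    (isClosed_univ : IsClosed ((⊤ : Submodule ℂ X) : Set X)).completeSpace_coe
  have := core_invariant R ⊤ (by simp) (fun w _ => (hs w).imp (by simp))
  exact Set.eq_univ_of_univ_subset (by simpa using this)

/-- Jordan product of `T` with a rank one operator. -/
noncomputable def jr (T : X →L[ℂ] X) (x : X) (f : X →L[ℂ] ℂ) : X →L[ℂ] X :=
  T * f.smulRight x + f.smulRight x * T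

theorem jr_apply (T : X →L[ℂ] X) (x : X) (f : X →L[ℂ] ℂ) (z : X) :
    jr T x f z = f z • T x + f (T z) • x := by
  simp [jr]

theorem jr_pq (T : X →L[ℂ] X) (x : X) (f : X →L[ℂ] ℂ) (p q : ℂ) :
    jr T x f (p • T x + q • x) =
      (p * f (T x) + q * f x) • T x + (p * f (T (T x)) + q * f (T x)) • x := by
  simp [jr_apply]

theorem jr_core_sub (T : X →L[ℂ] X) (x : X) (f : X →L[ℂ] ℂ) {w : X}
    (hw : w ∈ analyticCore (jr T x f)) : ∃ p q : ℂ, w = p • T x + q • x := by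
  obtain ⟨y, -, rfl⟩ := core_pre _ hw
  exact ⟨_, _, jr_apply T x f y⟩

theorem jr_eig (T : X →L[ℂ] X) (x : X) (f : X →L[ℂ] ℂ) (hf : f x = 1) (s : ℂ)
    (hs : s ^ 2 = f (T (T x))) (hts : f (T x) + s ≠ 0) :
    T x + s • x ∈ analyticCore (jr T x f) := by
  apply core_eigen _ _ _ hts
  have := jr_pq T x f 1 s
  rw [one_smul] at this
  rw [this, hf, ← hs]
  module

theorem jr_trace (T : X →L[ℂ] X) (x : X) (f : X →L[ℂ] ℂ) (hf : f x = 1)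
    (ht : f (T x) ≠ 0) : ∃ w ∈ analyticCore (jr T x f), w ≠ 0 := by
  obtain ⟨s, hs⟩ : ∃ s : ℂ, s ^ 2 = f (T (T x)) := IsAlgClosed.exists_pow_nat_eq _ (by norm_num)
  have : ∃ s : ℂ, s ^ 2 = f (T (T x)) ∧ f (T x) + s ≠ 0 := by
    by_cases h : f (T x) + s = 0
    · refine ⟨-s, by rw [← hs]; ring, fun h' => ht ?_⟩
      linear_combination (h + h') / 2
    · exact ⟨s, hs, h⟩
  obtain ⟨s, hs, h⟩ := this
  refine ⟨_, jr_eig T x f hf s hs h, fun h0 => h ?_⟩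
  have := congrArg f h0
  simpa [hf] using this

theorem jr_nil (T : X →L[ℂ] X) (x : X) (f : X →L[ℂ] ℂ) 
    (ht : f (T x) = 0) (hc : f (T (T x)) = 0) {w : X} (hw : w ∈ analyticCore (jr T x f)) :
    w = 0 := by
  obtain ⟨y, hy, rfl⟩ := core_pre _ hw
  obtain ⟨z, hz, rfl⟩ := core_pre _ hy
  obtain ⟨p, q, rfl⟩ := jr_core_sub T x f hz
  rw [jr_pq, jr_pq]
  simp [ht, hc]

theorem jr_det (T : X →L[ℂ] X) (x : X) (f : X →L[ℂ] ℂ)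
    (hd : f (T x) ^ 2 - f x * f (T (T x)) ≠ 0) (p q : ℂ) :
    p • T x + q • x ∈ analyticCore (jr T x f) := by
  have hfd : FiniteDimensional ℂ (Submodule.span ℂ {T x, x}) :=
    FiniteDimensional.span_of_finite ℂ (Set.toFinite _)
  have : CompleteSpace (Submodule.span ℂ {T x, x}) := FiniteDimensional.complete ℂ _
  have := core_invariant (jr T x f) (Submodule.span ℂ {T x, x}) ?_ ?_
  · exact this (Submodule.mem_span_pair.2 ⟨p, q, rfl⟩)
  · intro w hw
    exact Submodule.mem_span_pair.2 ⟨_, _, (jr_apply T x f w).symm⟩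
  · intro w hw
    obtain ⟨p, q, rfl⟩ := Submodule.mem_span_pair.1 hw
    set D := f (T x) ^ 2 - f x * f (T (T x)) with hD
    refine ⟨((p * f (T x) - q * f x) / D) • T x + ((q * f (T x) - p * f (T (T x))) / D) • x,
      Submodule.mem_span_pair.2 ⟨_, _, rfl⟩, ?_⟩
    rw [jr_pq]
    congr 2
    · field_simp
      rw [hD]; ring
    · field_simp
      rw [hD]; ring

/-- Prescribing values of a functional. -/
theorem exists_dual {n : ℕ} (v : Fin n → X) (hv : LinearIndependent ℂ v) (c : Fin n → ℂ) :
    ∃ f : X →L[ℂ] ℂ, ∀ i, f (v i) = c i := by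
  let b := Module.Basis.span hv
  have hfd : FiniteDimensional ℂ (Submodule.span ℂ (Set.range v)) := b.finiteDimensional_of_finite
  let g : (Submodule.span ℂ (Set.range v)) →L[ℂ] ℂ := LinearMap.toContinuousLinearMap (b.constr ℂ c)
  obtain ⟨f, hf, -⟩ := exists_extension_norm_eq _ g
  refine ⟨f, fun i => ?_⟩
  have h1 : ((b i : Submodule.span ℂ (Set.range v)) : X) = v i := by
    simp [b, Module.Basis.span_apply]
  rw [← h1, hf]
  simp [g]

theorem exists_dual2 (x y : X) (h : LinearIndependent ℂ ![x, y]) (a b : ℂ) :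
    ∃ f : X →L[ℂ] ℂ, f x = a ∧ f y = b := by
  obtain ⟨f, hf⟩ := exists_dual _ h ![a, b]
  exact ⟨f, hf 0, hf 1⟩

/-- Locally dependent linear maps. -/
theorem loc_dep {V W : Type*} [AddCommGroup V] [Module ℂ V] [AddCommGroup W] [Module ℂ W]
    (A T : V →ₗ[ℂ] W) (h : ∀ z, ∃ c : ℂ, A z = c • T z) : ∃ c : ℂ, ∀ z, A z = c • T z := by
  by_cases hT : ∀ z, T z = 0
  · exact ⟨0, fun z => by obtain ⟨c, hc⟩ := h z; simp [hc, hT]⟩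
  push Not at hT
  obtain ⟨x, hx⟩ := hT
  obtain ⟨c, hc⟩ := h x
  refine ⟨c, fun y => ?_⟩
  by_cases hy : ∃ d : ℂ, T y = d • T x
  · obtain ⟨d, hd⟩ := hy
    obtain ⟨e, he⟩ := h (y - d • x)
    simp only [map_sub, map_smul, hd, sub_self, smul_zero, hc] at he
    rw [sub_eq_zero.1 he, hd, smul_comm]
  · obtain ⟨d, hd⟩ := h y
    obtain ⟨e, he⟩ := h (x + y)
    rw [map_add, map_add, hc, hd] at he
    have h1 : (d - e) • T y = (e - c) • T x := by
      rw [← sub_eq_zero, ← sub_eq_zero.2 he]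
      module
    by_cases hde : d - e = 0
    · rw [hde, zero_smul] at h1
      have := (smul_eq_zero.1 h1.symm).resolve_right hx
      rw [hd]
      congr 1
      linear_combination hde + this
    · exact absurd ⟨(d - e)⁻¹ * (e - c), by rw [mul_smul, ← h1, smul_smul, inv_mul_cancel₀ hde, one_smul]⟩ hy


theorem exists_ndet (x y z : X) (h : LinearIndependent ℂ ![x, y]) :
    ∃ f : X →L[ℂ] ℂ, f x = 1 ∧ (f y) ^ 2 - f z ≠ 0 := by
  obtain ⟨f, hx, hy⟩ := exists_dual2 x y h 1 0
  obtain ⟨g, gx, gy⟩ := exists_dual2 x y h 1 1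
  by_contra! H
  have h1 := H f hx
  have h2 := H g gx
  have h3 := H ((2 : ℂ) • f - g) (by simp [hx, gx]; norm_num)
  simp [hx, hy, gx, gy] at h1 h2 h3
  rw [h1] at h3
  have : (2 : ℂ) = 0 := by linear_combination h3 + h2
  norm_num at this

theorem exists_root (x y z : X) (h : LinearIndependent ℂ ![x, y]) :
    ∃ f : X →L[ℂ] ℂ, f x = 1 ∧ f z = (f y) ^ 2 := by
  by_cases hz : z ∈ Submodule.span ℂ (Set.range ![x, y])
  · have hz' : z ∈ Submodule.span ℂ {x, y} := by
      simpa [Matrix.range_cons, Matrix.range_empty, Set.pair_comm] using hz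
    obtain ⟨a, b, rfl⟩ := Submodule.mem_span_pair.1 hz'
    obtain ⟨s, hs⟩ : ∃ s : ℂ, s ^ 2 = b ^ 2 / 4 + a := IsAlgClosed.exists_pow_nat_eq _ (by norm_num)
    obtain ⟨f, hx, hy⟩ := exists_dual2 x y h 1 (s + b / 2)
    refine ⟨f, hx, ?_⟩
    simp only [map_add, map_smul, hx, hy, smul_eq_mul]
    linear_combination -hs
  · have h3 : LinearIndependent ℂ ![z, x, y] := linearIndependent_finCons.2 ⟨h, hz⟩
    obtain ⟨f, hf⟩ := exists_dual _ h3 ![0, 1, 0]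
    have h0 : f z = 0 := hf 0
    have h1 : f x = 1 := hf 1
    have h2 : f y = 0 := hf 2
    exact ⟨f, h1, by simp [h0, h2]⟩

theorem indep_of {x y : X} (hx : x ≠ 0) (h : ¬ ∃ c : ℂ, y = c • x) :
    LinearIndependent ℂ ![x, y] :=
  (LinearIndependent.pair_iff' hx).2 fun a ha => h ⟨a, ha.symm⟩

theorem exists_dual1 {x : X} (hx : x ≠ 0) : ∃ f : X →L[ℂ] ℂ, f x = 1 := by
  obtain ⟨f, hf⟩ := SeparatingDual.exists_eq_one (R := ℂ) hx
  exact ⟨f, hf⟩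

theorem final_pt (A T : X →L[ℂ] X)
    (hK : ∀ (x : X) (f : X →L[ℂ] ℂ), f x = 1 →
      analyticCore (jr A x f) = analyticCore (jr T x f)) (x : X) : ∃ c : ℂ, A x = c • T x := by
  by_cases hx : x = 0
  · exact ⟨0, by simp [hx]⟩
  by_cases hd : ∃ τ : ℂ, T x = τ • x
  · obtain ⟨τ, hτ⟩ := hd
    have hA : ∃ α : ℂ, A x = α • x := by
      by_contra hA
      obtain ⟨f, hf, hdet⟩ := exists_ndet x (A x) (A (A x)) (indep_of hx hA)
      have hm := jr_det A x f (by rwa [hf, one_mul]) 1 0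
      rw [hK x f hf] at hm
      obtain ⟨p, q, hpq⟩ := jr_core_sub T x f hm
      apply hA
      refine ⟨p * τ + q, ?_⟩
      rw [one_smul, zero_smul, add_zero, hτ] at hpq
      rw [hpq]; module
    obtain ⟨α, hα⟩ := hA
    by_cases h0 : τ = 0
    · obtain ⟨f, hf⟩ := exists_dual1 hx
      refine ⟨0, ?_⟩
      by_cases ha : α = 0
      · simp [hα, ha]
      obtain ⟨w, hw, hw0⟩ := jr_trace A x f hf (by simp [hα, hf, ha])
      rw [hK x f hf] at hw
      exact absurd (jr_nil T x f (by simp [hτ, h0]) (by simp [hτ, h0]) hw) hw0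
    · refine ⟨α / τ, ?_⟩
      rw [hα, hτ, smul_smul, div_mul_cancel₀ _ h0]
  · have hind := indep_of hx hd
    have hA : ∃ a b : ℂ, b ≠ 0 ∧ A x = b • T x + a • x := by
      obtain ⟨f, hf, hdet⟩ := exists_ndet x (T x) (T (T x)) hind
      have hm := jr_det T x f (by rwa [hf, one_mul]) 1 0
      rw [← hK x f hf] at hm
      obtain ⟨p, q, hpq⟩ := jr_core_sub A x f hm
      rw [one_smul, zero_smul, add_zero] at hpq
      have hp : p ≠ 0 := by
        rintro rfl
        exact hd ⟨q, by simpa using hpq⟩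
      refine ⟨-(p⁻¹ * q), p⁻¹, inv_ne_zero hp, ?_⟩
      rw [hpq, smul_add, smul_smul, smul_smul, inv_mul_cancel₀ hp]
      module
    obtain ⟨a, b, hb, hA⟩ := hA
    suffices ha : a = 0 from ⟨b, by rw [hA, ha]; simp⟩
    have hli : ∀ p q : ℂ, p • T x + q • x = 0 → p = 0 ∧ q = 0 := by
      intro p q h
      have := LinearIndependent.pair_iff.1 hind q p (by rw [add_comm]; exact h)
      exact ⟨this.2, this.1⟩
    obtain ⟨f, hf, hroot⟩ := exists_root x (T x) (T (T x)) hind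
    have hfA : f (A x) = b * f (T x) + a := by simp [hA, hf]
    by_cases ht : f (T x) = 0
    · by_contra ha
      obtain ⟨w, hw, hw0⟩ := jr_trace A x f hf (by simpa [hfA, ht] using ha)
      rw [hK x f hf] at hw
      exact hw0 (jr_nil T x f ht (by simp [hroot, ht]) hw)
    · have hsub : ∀ w ∈ analyticCore (jr A x f), ∃ k : ℂ, w = k • (T x + f (T x) • x) := by
        intro w hw
        rw [hK x f hf] at hw
        obtain ⟨y, hy, rfl⟩ := core_pre _ hw
        obtain ⟨p, q, rfl⟩ := jr_core_sub T x f hy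
        refine ⟨p * f (T x) + q, ?_⟩
        rw [jr_pq, hf, hroot]
        module
      have hdet : f (A x) ^ 2 = f (A (A x)) := by
        by_contra hne
        have hm := jr_det A x f (by rw [hf, one_mul]; exact sub_ne_zero.2 hne) 0 1
        obtain ⟨k, hk⟩ := hsub _ hm
        have := hli k (k * f (T x) - 1) (by
          rw [zero_smul, zero_add, one_smul] at hk
          rw [eq_comm, ← sub_eq_zero] at hk
          rw [← hk]
          module)
        rw [this.1] at this
        simp at this
      have ht' : f (A x) ≠ 0 := by
        intro h0
        obtain ⟨w, hw, hw0⟩ := jr_trace T x f hf ht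
        rw [← hK x f hf] at hw
        exact hw0 (jr_nil A x f h0 (by rw [← hdet, h0]; simp) hw)
      have hm := jr_eig A x f hf (f (A x)) hdet (by
        rw [← two_mul]; exact mul_ne_zero two_ne_zero ht')
      obtain ⟨k, hk⟩ := hsub _ hm
      have := hli (b - k) (a + f (A x) - k * f (T x)) (by
        rw [← sub_eq_zero] at hk
        have h9 : (b - k) • T x + (a + f (A x) - k * f (T x)) • x =
            (b • T x + a • x) + f (A x) • x - k • (T x + f (T x) • x) := by module
        rw [h9, ← hA, hk])
      rw [hfA] at this
      linear_combination this.2 / 2 - f (T x) * this.1 / 2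

theorem final_lin (A T : X →L[ℂ] X)
    (hK : ∀ (x : X) (f : X →L[ℂ] ℂ), f x = 1 →
      analyticCore (jr A x f) = analyticCore (jr T x f)) : ∃ c : ℂ, c ≠ 0 ∧ A = c • T := by
  obtain ⟨c, hc⟩ := loc_dep (A : X →ₗ[ℂ] X) (T : X →ₗ[ℂ] X) (final_pt A T hK)
  obtain ⟨d, hd⟩ := loc_dep (T : X →ₗ[ℂ] X) (A : X →ₗ[ℂ] X)
    (final_pt T A fun x f hf => (hK x f hf).symm)
  have hc : A = c • T := ContinuousLinearMap.ext hc
  have hd : T = d • A := ContinuousLinearMap.ext hd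
  by_cases h : c = 0
  · rw [h, zero_smul] at hc
    rw [hc, smul_zero] at hd
    exact ⟨1, one_ne_zero, by rw [hc, hd, smul_zero]⟩
  · exact ⟨c, h, hc⟩

section phi
variable [CompleteSpace X] (phi : (X →L[ℂ] X) → (X →L[ℂ] X))

theorem phi_core (H : ∀ T S : X →L[ℂ] X,
      analyticCore (phi T * phi S + phi S * phi T) = analyticCore (T * S + S * T))
    (S : X →L[ℂ] X) : analyticCore (phi S) = analyticCore S := by
  have := H S S
  rwa [← two_smul ℂ (phi S * phi S), ← two_smul ℂ (S * S), core_smul _ _ two_ne_zero,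
    core_smul _ _ two_ne_zero, core_sq, core_sq] at this

theorem phi_rank_one (hX : ¬ FiniteDimensional ℂ X) (H : ∀ T S : X →L[ℂ] X,
      analyticCore (phi T * phi S + phi S * phi T) = analyticCore (T * S + S * T))
    (S : X →L[ℂ] X) (x : X) (f : X →L[ℂ] ℂ) (hf : f x = 1) (hS : phi S = f.smulRight x) :
    ∃ (μ : ℂ) (h : X →L[ℂ] ℂ), μ ≠ 0 ∧ h x = 1 ∧ S = μ • h.smulRight x := by
  have hx : x ≠ 0 := by rintro rfl; simp at hf
  have hKS := phi_core phi H S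
  have hsub : ∀ w ∈ analyticCore S, ∃ c : ℂ, w = c • x := by
    intro w hw
    rw [← hKS, hS] at hw
    obtain ⟨y, -, rfl⟩ := core_pre _ hw
    exact ⟨f y, by simp⟩
  have hxS : x ∈ analyticCore S := by
    rw [← hKS, hS]
    exact core_eigen _ _ 1 one_ne_zero (by simp [hf])
  obtain ⟨μ, hμ, hSx⟩ : ∃ μ : ℂ, μ ≠ 0 ∧ S x = μ • x := by
    obtain ⟨y, hy, hyx⟩ := core_pre _ hxS
    obtain ⟨c, rfl⟩ := hsub y hy
    have hc : c ≠ 0 := by rintro rfl; simp at hyx; exact hx hyx.symm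
    refine ⟨c⁻¹, inv_ne_zero hc, ?_⟩
    rw [map_smul] at hyx
    nth_rewrite 2 [← hyx]
    rw [smul_smul, inv_mul_cancel₀ hc, one_smul]
  have hloc : ∀ y, ∃ a b : ℂ, S y = a • y + b • x := by
    intro y
    by_cases hy : ∃ c : ℂ, y = c • x
    · obtain ⟨c, rfl⟩ := hy
      exact ⟨0, c * μ, by rw [map_smul, hSx]; module⟩
    by_cases hSy : ∃ c : ℂ, S y = c • y
    · obtain ⟨c, hc⟩ := hSy
      exact ⟨c, 0, by rw [hc]; simp⟩
    have hy0 : y ≠ 0 := by rintro rfl; exact hy ⟨0, by simp⟩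
    obtain ⟨g, g1, g2⟩ := exists_dual2 y (S y) (indep_of hy0 hSy) 0 1
    have hd : g (S y) ^ 2 - g y * g (S (S y)) ≠ 0 := by simp [g1, g2]
    have hHH : analyticCore (jr S y g) = analyticCore (jr (phi (g.smulRight y)) x f) := by
      rw [jr, jr, ← H, ← hS, add_comm]
    have e1 := jr_det S y g hd 0 1
    have e2 := jr_det S y g hd 1 0
    rw [hHH] at e1 e2
    obtain ⟨p1, q1, h1⟩ := jr_core_sub _ _ _ e1
    obtain ⟨p2, q2, h2⟩ := jr_core_sub _ _ _ e2
    rw [zero_smul, zero_add, one_smul] at h1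
    rw [zero_smul, add_zero, one_smul] at h2
    have hp1 : p1 ≠ 0 := by
      rintro rfl
      exact hy ⟨q1, by simpa using h1⟩
    refine ⟨p1⁻¹ * p2, q2 - p1⁻¹ * p2 * q1, ?_⟩
    rw [h2]
    generalize phi (g.smulRight y) x = v at h1
    rw [h1, smul_add, smul_smul, show p1⁻¹ * p2 * p1 = p2 by field_simp]
    module
  obtain ⟨l, hl⟩ := loc_dep ((Submodule.span ℂ {x}).mkQ ∘ₗ (S : X →ₗ[ℂ] X))
    ((Submodule.span ℂ {x}).mkQ) (by
      intro z
      obtain ⟨a, b, hab⟩ := hloc z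
      refine ⟨a, ?_⟩
      rw [← map_smul, LinearMap.comp_apply, ← sub_eq_zero, ← map_sub]
      simp only [Submodule.mkQ_apply, Submodule.Quotient.mk_eq_zero]
      exact Submodule.mem_span_singleton.2 ⟨b, by simp [hab]⟩)
  let h : X →L[ℂ] ℂ := f.comp (S - l • ContinuousLinearMap.id ℂ X)
  have hh : ∀ z, S z = l • z + h z • x := by
    intro z
    have h1 := hl z
    rw [← map_smul, LinearMap.comp_apply, ← sub_eq_zero, ← map_sub] at h1
    simp only [Submodule.mkQ_apply, Submodule.Quotient.mk_eq_zero] at h1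
    obtain ⟨c, hc⟩ := Submodule.mem_span_singleton.1 h1
    have h2 : h z = c := by
      have h3 : h z = f (S z - l • z) := rfl
      rw [h3]
      have := congrArg f hc
      simpa [hf] using this.symm
    rw [h2, hc]; simp
  have hl0 : l = 0 := by
    by_contra hl0
    apply hX
    have hs : Function.Surjective S := by
      intro z
      refine ⟨l⁻¹ • (z - (h z / μ) • x), ?_⟩
      rw [map_smul, map_sub, map_smul, hSx, smul_smul, div_mul_cancel₀ _ hμ, hh z,
        add_sub_cancel_right, smul_smul, inv_mul_cancel₀ hl0, one_smul]
    have hu := core_surj S hs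
    have htop : Submodule.span ℂ {x} = ⊤ := by
      rw [eq_top_iff]
      intro z _
      obtain ⟨c, hc⟩ := hsub z (by rw [hu]; trivial)
      exact Submodule.mem_span_singleton.2 ⟨c, hc.symm⟩
    exact Module.finite_def.2 (htop ▸ Submodule.fg_span (Set.finite_singleton x))
  have hhx : h x = μ := by
    have h1 := hh x
    rw [hSx, hl0, zero_smul, zero_add] at h1
    exact (smul_left_injective ℂ hx h1).symm
  refine ⟨μ, μ⁻¹ • h, hμ, by simp [hhx, hμ], ?_⟩
  ext z
  rw [hh z, hl0]
  simp [smul_smul, hμ]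

theorem jr_smul_left (S : X →L[ℂ] X) (x : X) (f : X →L[ℂ] ℂ) (c : ℂ) (hc : c ≠ 0) :
    analyticCore (S * (c • f.smulRight x) + (c • f.smulRight x) * S) = analyticCore (jr S x f) := by
  rw [mul_smul_comm, smul_mul_assoc, ← smul_add, core_smul _ _ hc, jr]

theorem phi_rank_one' (hX : ¬ FiniteDimensional ℂ X) (hsurj : Function.Surjective phi)
    (H : ∀ T S : X →L[ℂ] X,
      analyticCore (phi T * phi S + phi S * phi T) = analyticCore (T * S + S * T))
    (S : X →L[ℂ] X) (x : X) (f : X →L[ℂ] ℂ) (hf : f x = 1) (hS : phi S = f.smulRight x) :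
    ∃ μ : ℂ, μ ≠ 0 ∧ S = μ • f.smulRight x := by
  have hx : x ≠ 0 := by rintro rfl; simp at hf
  obtain ⟨μ, h, hμ, hhx, hSh⟩ := phi_rank_one phi hX H S x f hf hS
  have key : ∀ y, f y = 0 → h y = 0 := by
    intro y hfy
    by_cases hy : y = 0
    · simp [hy]
    have hind : LinearIndependent ℂ ![x, y] := indep_of hx (by
      rintro ⟨c, rfl⟩
      simp [hf] at hfy
      exact hy (by simp [hfy]))
    obtain ⟨g, gx, gy⟩ := exists_dual2 x y hind 1 1
    obtain ⟨S1, hS1⟩ := hsurj (g.smulRight x)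
    obtain ⟨S2, hS2⟩ := hsurj (g.smulRight y)
    obtain ⟨μ1, h1, hμ1, hh1, e1⟩ := phi_rank_one phi hX H S1 x g gx hS1
    obtain ⟨μ2, k, hμ2, hk, e2⟩ := phi_rank_one phi hX H S2 y g gy hS2
    have E : ∀ S', analyticCore (jr (phi S') y g) = analyticCore (jr S' y k) := by
      intro S'
      rw [← jr_smul_left S' y k μ2 hμ2, ← e2, ← H, hS2, jr]
    have hkx : k x ≠ 0 := by
      intro h0
      obtain ⟨w, hw, hw0⟩ := jr_trace (phi S1) y g gy (by simp [hS1, gx, gy])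
      rw [E] at hw
      exact hw0 (jr_nil S1 y k (by simp [e1, h0]) (by simp [e1, h0]) hw)
    by_contra hhy
    obtain ⟨w, hw, hw0⟩ := jr_trace S y k hk (by simp [hSh, hμ, hhy, hkx])
    rw [← E] at hw
    exact hw0 (jr_nil (phi S) y g (by simp [hS, hfy]) (by simp [hS, hfy]) hw)
  have hfh : h = f := by
    ext z
    have := key (z - f z • x) (by simp [hf])
    simp [hhx] at this
    linear_combination this
  exact ⟨μ, hμ, by rw [hSh, hfh]⟩

end phi
end aux

theorem main_theorem {X : Type*} [NormedAddCommGroup X] [NormedSpace ℂ X]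
    [CompleteSpace X] (hX : ¬ FiniteDimensional ℂ X)
    (phi : (X →L[ℂ] X) → (X →L[ℂ] X)) (hsurj : Function.Surjective phi) :
    (∀ T S : X →L[ℂ] X,
        analyticCore (phi T * phi S + phi S * phi T) = analyticCore (T * S + S * T)) ↔
      ∃ gamma : (X →L[ℂ] X) → ℂ, (∀ T, gamma T ≠ 0) ∧ ∀ T, phi T = gamma T • T := by
  constructor
  · intro H
    have : ∀ T, ∃ c : ℂ, c ≠ 0 ∧ phi T = c • T := by
      intro T
      apply final_lin
      intro x f hf
      obtain ⟨S, hS⟩ := hsurj (f.smulRight x)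
      obtain ⟨μ, hμ, e⟩ := phi_rank_one' phi hX hsurj H S x f hf hS
      rw [← jr_smul_left T x f μ hμ, ← e, ← H, hS, jr]
    choose g hg hg' using this
    exact ⟨g, hg, hg'⟩
  · rintro ⟨g, hg, hg'⟩ T S
    have : phi T * phi S + phi S * phi T = (g T * g S) • (T * S + S * T) := by
      rw [hg' T, hg' S]
      simp only [smul_mul_assoc, mul_smul_comm, smul_smul, smul_add, mul_comm]
    rw [this, core_smul _ _ (mul_ne_zero (hg T) (hg S))]
end

section
/- Let X be an infinite-dimensional complex Banach space and φ : B(X) → B(X) a surjective map. Then the condition 'i_{φ(T)φ(S)+φ(S)φ(T)}(x) = 0 ⟺ i_{TS+ST}(x) = 0 for all x ∈ X and all T, S ∈ B(X)' holds if and only if there is a map γ : B(X) → ℂ \ {0} with φ(T) = γ(T)·T for all T. -/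
/-- The glocal spectral subspace `X_T(F)` for a closed set `F ⊆ ℂ`. -/
def glocalSubspace {X : Type*} [NormedAddCommGroup X] [NormedSpace ℂ X]
    (T : X →L[ℂ] X) (F : Set ℂ) : Set X :=
  {x | ∃ f : ℂ → X, AnalyticOnNhd ℂ f Fᶜ ∧ ∀ lam ∉ F, T (f lam) - lam • f lam = x}

/-- The local resolvent set of `T` at `x`. -/
def localResolvent {X : Type*} [NormedAddCommGroup X] [NormedSpace ℂ X]
    (T : X →L[ℂ] X) (x : X) : Set ℂ :=
  {lam | ∃ U : Set ℂ, IsOpen U ∧ lam ∈ U ∧ ∃ f : ℂ → X, AnalyticOnNhd ℂ f U ∧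
    ∀ mu ∈ U, T (f mu) - mu • f mu = x}

/-- The local spectrum of `T` at `x`. -/
def localSpectrum {X : Type*} [NormedAddCommGroup X] [NormedSpace ℂ X]
    (T : X →L[ℂ] X) (x : X) : Set ℂ :=
  (localResolvent T x)ᶜ

/-- The inner local spectral radius of `T` at `x`. -/
noncomputable def innerLocalRadius {X : Type*} [NormedAddCommGroup X] [NormedSpace ℂ X]
    (T : X →L[ℂ] X) (x : X) : ENNReal :=
  ⨆ r ∈ {r : ℝ | 0 ≤ r ∧ x ∈ glocalSubspace T {lam : ℂ | r ≤ ‖lam‖}},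
    ENNReal.ofReal r

/-- The single-valued extension property. -/
def HasSVEP {X : Type*} [NormedAddCommGroup X] [NormedSpace ℂ X]
    (T : X →L[ℂ] X) : Prop :=
  ∀ U : Set ℂ, IsOpen U → ∀ f : ℂ → X, AnalyticOnNhd ℂ f U →
    (∀ lam ∈ U, T (f lam) - lam • f lam = 0) → ∀ lam ∈ U, f lam = 0

section innerRadiusHelpers

variable {X : Type*} [NormedAddCommGroup X] [NormedSpace ℂ X]

/-- Sequence description of the vectors with nonzero inner local radius. -/
def KS (M : X →L[ℂ] X) : Submodule ℂ X where
  carrier := {x | ∃ (C d : ℝ) (u : ℕ → X), 0 ≤ C ∧ 0 < d ∧ u 0 = x ∧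
    (∀ n, M (u (n + 1)) = u n) ∧ ∀ n, ‖u n‖ ≤ C * d ^ n}
  zero_mem' := ⟨0, 1, fun _ => 0, le_rfl, one_pos, rfl, by simp, by simp⟩
  add_mem' := by
    rintro x y ⟨C, d, u, hC, hd, hu0, hu, hb⟩ ⟨C', d', u', hC', hd', hu0', hu', hb'⟩
    refine ⟨C + C', max d d', fun n => u n + u' n, by positivity, lt_max_of_lt_left hd,
      by simp [hu0, hu0'], fun n => by simp [hu, hu'], fun n => ?_⟩
    calc ‖u n + u' n‖ ≤ ‖u n‖ + ‖u' n‖ := norm_add_le _ _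
      _ ≤ C * d ^ n + C' * d' ^ n := add_le_add (hb n) (hb' n)
      _ ≤ C * max d d' ^ n + C' * max d d' ^ n := by
        gcongr
        · exact le_max_left _ _
        · exact le_max_right _ _
      _ = _ := by ring
  smul_mem' := by
    rintro c x ⟨C, d, u, hC, hd, hu0, hu, hb⟩
    refine ⟨‖c‖ * C, d, fun n => c • u n, by positivity, hd, by simp [hu0],
      fun n => by simp [hu], fun n => ?_⟩
    rw [norm_smul, mul_assoc]
    gcongr
    exact hb n

lemma KS_mem {M : X →L[ℂ] X} {x : X} : x ∈ KS M ↔ ∃ (C d : ℝ) (u : ℕ → X), 0 ≤ C ∧ 0 < d ∧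
    u 0 = x ∧ (∀ n, M (u (n + 1)) = u n) ∧ ∀ n, ‖u n‖ ≤ C * d ^ n := Iff.rfl

lemma KS_surj {M : X →L[ℂ] X} {x : X} (h : x ∈ KS M) : ∃ y ∈ KS M, M y = x := by
  obtain ⟨C, d, u, hC, hd, hu0, hu, hb⟩ := h
  refine ⟨u 1, ⟨C * d, d, fun n => u (n + 1), by positivity, hd, rfl, fun n => hu _, fun n => ?_⟩,
    by rw [← hu0]; exact hu 0⟩
  calc _ ≤ _ := hb _
    _ = _ := by ring

lemma KS_tri {M : X →L[ℂ] X} {k y : X} {m : ℂ} (hm : m ≠ 0) (hk : k ∈ KS M)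
    (hy : M y = m • y + k) : y ∈ KS M := by
  obtain ⟨C, d, u, hC, hd, hu0, hu, hb⟩ := hk
  let v : ℕ → X := fun n => Nat.rec y (fun n w => m⁻¹ • (w - u (n + 1))) n
  have hv0 : v 0 = y := rfl
  have hv : ∀ n, v (n + 1) = m⁻¹ • (v n - u (n + 1)) := fun n => rfl
  have key : ∀ n, M (v n) = m • v n + u n := by
    intro n
    induction n with
    | zero => rw [hv0, hu0, hy]
    | succ n ih =>
      rw [hv, map_smul, map_sub, ih, hu, smul_smul, mul_inv_cancel₀ hm, one_smul,
        add_sub_cancel_right, smul_smul, inv_mul_cancel₀ hm, one_smul]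
      abel
  set D : ℝ := ‖m‖⁻¹ * (1 + C) * max 1 d + d with hD
  have hmpos : 0 < ‖m‖ := norm_pos_iff.2 hm
  have hDd : d ≤ D := by rw [hD]; have : 0 ≤ ‖m‖⁻¹ * (1 + C) * max 1 d := by positivity
                         linarith
  have hDpos : 0 < D := lt_of_lt_of_le hd hDd
  refine ⟨1 + ‖y‖, D, v, by positivity, hDpos, hv0, fun n => ?_, fun n => ?_⟩
  · rw [hv, map_smul, map_sub, key, hu, add_sub_cancel_right, smul_smul, inv_mul_cancel₀ hm,
      one_smul]
  · induction n with
    | zero => simp [hv0]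
    | succ n ih =>
      have h1 : ‖u (n + 1)‖ ≤ C * max 1 d * ((1 + ‖y‖) * D ^ n) := by
        calc ‖u (n + 1)‖ ≤ C * d ^ (n + 1) := hb _
          _ = C * d * (1 * d ^ n) := by ring
          _ ≤ C * max 1 d * ((1 + ‖y‖) * D ^ n) := by
            gcongr
            · exact le_max_right _ _
            · linarith [norm_nonneg y]
      have h2 : ‖v n‖ ≤ max 1 d * ((1 + ‖y‖) * D ^ n) := by
        refine ih.trans ?_
        have : 0 ≤ (1 + ‖y‖) * D ^ n := by positivity
        exact le_mul_of_one_le_left this (le_max_left _ _)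
      have hp : 0 ≤ (1 + ‖y‖) * D ^ n := by positivity
      calc ‖v (n + 1)‖ = ‖m‖⁻¹ * ‖v n - u (n + 1)‖ := by rw [hv, norm_smul, norm_inv]
        _ ≤ ‖m‖⁻¹ * (‖v n‖ + ‖u (n + 1)‖) := by gcongr; exact norm_sub_le _ _
        _ ≤ ‖m‖⁻¹ * (max 1 d * ((1 + ‖y‖) * D ^ n) + C * max 1 d * ((1 + ‖y‖) * D ^ n)) := by
          gcongr
        _ = (‖m‖⁻¹ * (1 + C) * max 1 d) * ((1 + ‖y‖) * D ^ n) := by ring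
        _ ≤ D * ((1 + ‖y‖) * D ^ n) := by
          gcongr; rw [hD]; linarith
        _ = _ := by ring

lemma KS_eig {M : X →L[ℂ] X} {y : X} {m : ℂ} (hm : m ≠ 0)
    (hy : M y = m • y) : y ∈ KS M :=
  KS_tri hm (KS M).zero_mem (by simpa using hy)

lemma KS_smul_le {M : X →L[ℂ] X} {c : ℂ} (hc : c ≠ 0) {x : X} (h : x ∈ KS M) :
    x ∈ KS (c • M) := by
  obtain ⟨C, d, u, hC, hd, hu0, hu, hb⟩ := h
  have hcpos : 0 < ‖c‖ := norm_pos_iff.2 hc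
  refine ⟨C, ‖c‖⁻¹ * d, fun n => (c⁻¹) ^ n • u n, hC, by positivity, by simp [hu0], fun n => ?_,
    fun n => ?_⟩
  · simp only [smul_apply, map_smul, hu, smul_smul]
    rw [pow_succ, mul_assoc, inv_mul_cancel₀ hc, mul_one]
  · rw [norm_smul, norm_pow, norm_inv, mul_pow]
    have := mul_le_mul_of_nonneg_left (hb n) (show 0 ≤ ‖c‖⁻¹ ^ n by positivity)
    linarith

lemma KS_smul {M : X →L[ℂ] X} {c : ℂ} (hc : c ≠ 0) : KS (c • M) = KS M := by
  ext x
  refine ⟨fun h => ?_, KS_smul_le hc⟩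
  have := KS_smul_le (inv_ne_zero hc) h
  rwa [smul_smul, inv_mul_cancel₀ hc, one_smul] at this

lemma KS_inv {M R : X →L[ℂ] X} (hc : ∀ z, R (M z) = M (R z)) {x : X} (h : x ∈ KS M) :
    R x ∈ KS M := by
  obtain ⟨C, d, u, hC, hd, hu0, hu, hb⟩ := h
  refine ⟨‖R‖ * C, d, fun n => R (u n), by positivity, hd, by simp [hu0], fun n => ?_,
    fun n => ?_⟩
  · rw [← hc, hu]
  · rw [mul_assoc]
    exact (R.le_opNorm _).trans (by gcongr; exact hb n)

lemma KS_of_radius {M : X →L[ℂ] X} {x : X} (h : innerLocalRadius M x ≠ 0) : x ∈ KS M := by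
  rw [innerLocalRadius, ne_eq, ENNReal.iSup_eq_zero, not_forall] at h
  obtain ⟨r, h⟩ := h
  rw [ENNReal.iSup_eq_zero, not_forall] at h
  obtain ⟨⟨-, f, hf, hfx⟩, h⟩ := h
  have hr : 0 < r := by
    by_contra hr
    exact h (ENNReal.ofReal_of_nonpos (not_lt.1 hr))
  have hf0 : AnalyticAt ℂ f 0 := hf 0 (by simpa using hr)
  obtain ⟨p, hp⟩ := hf0
  have hM0 : M (f 0) = x := by simpa using hfx 0 (by simpa using hr)
  have hds := HasFPowerSeriesAt.has_fpower_series_dslope_fslope hp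
  have hball : Metric.ball (0 : ℂ) r ∈ nhds (0 : ℂ) := Metric.ball_mem_nhds _ hr
  have hpunct : ∀ z ∈ Metric.ball (0 : ℂ) r, z ≠ 0 → M (dslope f 0 z) = f z := by
    intro z hz hz0
    have h1 := hfx z (by simpa using hz)
    rw [dslope_of_ne _ hz0, slope_def_module, map_smul, map_sub, hM0, sub_zero, ← h1]
    rw [sub_sub_cancel, smul_smul, inv_mul_cancel₀ hz0, one_smul]
  have hc1 : ContinuousAt (fun z => M (dslope f 0 z)) 0 :=
    M.continuous.continuousAt.comp hds.continuousAt
  have hev : (fun z => M (dslope f 0 z)) =ᶠ[nhds 0] f := by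
    have h2 : (fun z => M (dslope f 0 z)) =ᶠ[nhdsWithin 0 {0}ᶜ] f := by
      filter_upwards [nhdsWithin_le_nhds hball, self_mem_nhdsWithin] with z hz hz0
      exact hpunct z hz hz0
    exact (hc1.eventuallyEq_nhds_iff_eventuallyEq_nhdsNE hp.continuousAt).1 h2
  have hMds : HasFPowerSeriesAt (fun z => M (dslope f 0 z))
      (M.compFormalMultilinearSeries p.fslope) 0 := by
    obtain ⟨ρ, hρ⟩ := hds
    exact ⟨ρ, M.comp_hasFPowerSeriesOnBall hρ⟩
  have heq := (hMds.congr hev).eq_formalMultilinearSeries hp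
  obtain ⟨C, ρ, hC, hρ, hb⟩ := p.le_mul_pow_of_radius_pos hp.radius_pos
  have hcoef : ∀ n, M (p.coeff (n + 1)) = p.coeff n := by
    intro n
    rw [← FormalMultilinearSeries.coeff_fslope]
    conv_rhs => rw [← heq]
    rfl
  have hp0 : p.coeff 0 = f 0 := hp.coeff_zero 1
  have hnb : ∀ n, ‖p.coeff n‖ ≤ C * ρ ^ n := fun n => by
    have h3 := hb n
    rwa [FormalMultilinearSeries.norm_apply_eq_norm_coef] at h3
  have hmem : p.coeff 0 ∈ KS M := ⟨C, ρ, p.coeff, hC.le, hρ, rfl, hcoef, hnb⟩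
  rw [hp0] at hmem
  rw [← hM0]
  exact KS_inv (fun _ => rfl) hmem

lemma radius_of_KS [CompleteSpace X] {M : X →L[ℂ] X} {x : X} (h : x ∈ KS M) :
    innerLocalRadius M x ≠ 0 := by
  obtain ⟨C, d, u, hC, hd, hu0, hu, hb⟩ := h
  set r : ℝ := (2 * d)⁻¹ with hr
  have hrpos : 0 < r := by positivity
  have hset : {lam : ℂ | r ≤ ‖lam‖}ᶜ = Metric.ball 0 r := by
    ext z; simp
  have hbd : ∀ (n : ℕ) (w : ℂ), w ∈ Metric.ball (0 : ℂ) r →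
      ‖w ^ n • u (n + 1)‖ ≤ C * d * (1 / 2) ^ n := by
    intro n w hw
    have hw' : ‖w‖ ≤ r := by simpa using (le_of_lt (mem_ball_zero_iff.1 hw))
    rw [norm_smul, norm_pow]
    calc ‖w‖ ^ n * ‖u (n + 1)‖ ≤ r ^ n * (C * d ^ (n + 1)) := by gcongr; exact hb _
      _ = C * d * (r * d) ^ n := by ring
      _ = _ := by
        have : r * d = 1 / 2 := by rw [hr]; field_simp
        rw [this]
  have hsum : Summable (fun n : ℕ => C * d * (1 / 2 : ℝ) ^ n) :=
    summable_geometric_two.mul_left _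
  have hdiff : DifferentiableOn ℂ (fun w : ℂ => ∑' n : ℕ, w ^ n • u (n + 1))
      (Metric.ball 0 r) :=
    Complex.differentiableOn_tsum_of_summable_norm hsum
      (fun n => ((differentiable_id.pow n).smul_const _).differentiableOn)
      Metric.isOpen_ball hbd
  have hglocal : x ∈ glocalSubspace M {lam : ℂ | r ≤ ‖lam‖} := by
    refine ⟨fun w : ℂ => ∑' n : ℕ, w ^ n • u (n + 1), ?_, fun w hw => ?_⟩
    · rw [hset]
      exact hdiff.analyticOnNhd Metric.isOpen_ball
    · have hw' : w ∈ Metric.ball (0 : ℂ) r := by rw [← hset]; exact hw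
      have hs : Summable (fun n : ℕ => w ^ n • u (n + 1)) :=
        Summable.of_norm_bounded hsum (fun n => hbd n w hw')
      have hs' : Summable (fun n : ℕ => w ^ n • u n) := by
        rw [← summable_nat_add_iff 1]
        simpa only [pow_succ', mul_smul] using hs.const_smul w
      have e1 : M (∑' n : ℕ, w ^ n • u (n + 1)) = ∑' n : ℕ, w ^ n • u n := by
        rw [M.map_tsum hs]
        simp only [map_smul, hu]
      have e2 : w • ∑' n : ℕ, w ^ n • u (n + 1) = ∑' n : ℕ, w ^ (n + 1) • u (n + 1) := by
        rw [← hs.tsum_const_smul w]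
        simp only [pow_succ', mul_smul]
      simp only
      rw [e1, e2, hs'.tsum_eq_zero_add, hu0]
      simp
  rw [innerLocalRadius, ne_eq, ENNReal.iSup_eq_zero, not_forall]
  refine ⟨r, ?_⟩
  rw [ENNReal.iSup_eq_zero, not_forall]
  exact ⟨⟨hrpos.le, hglocal⟩, by simpa using hrpos⟩

lemma radius_iff [CompleteSpace X] {M : X →L[ℂ] X} {x : X} :
    innerLocalRadius M x = 0 ↔ x ∉ KS M :=
  ⟨fun h h' => radius_of_KS h' h, fun h => by
    by_contra h'
    exact h (KS_of_radius h')⟩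

/-- The Jordan product. -/
def jp (A B : X →L[ℂ] X) : X →L[ℂ] X := A * B + B * A

/-- Rank-one operator. -/
noncomputable def rk (f : X →L[ℂ] ℂ) (x : X) : X →L[ℂ] X := f.smulRight x

lemma jp_apply (A B : X →L[ℂ] X) (v : X) : jp A B v = A (B v) + B (A v) := rfl

lemma rk_apply (f : X →L[ℂ] ℂ) (x v : X) : rk f x v = f v • x := rfl

lemma jprk_apply (A : X →L[ℂ] X) (f : X →L[ℂ] ℂ) (x v : X) :
    jp A (rk f x) v = f v • A x + f (A v) • x := by
  simp [jp_apply, rk_apply]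

lemma sep (V : Submodule ℂ X) [FiniteDimensional ℂ V] {v : X} (hv : v ∉ V) :
    ∃ f : X →L[ℂ] ℂ, f v = 1 ∧ ∀ w ∈ V, f w = 0 := by
  have : IsClosed (V : Set X) := V.closed_of_finiteDimensional
  have hne : V.mkQ v ≠ 0 := by simpa using hv
  obtain ⟨g, hg⟩ := SeparatingDual.exists_eq_one (R := ℂ) hne
  refine ⟨g.comp V.mkQL, hg, fun w hw => ?_⟩
  have : V.mkQL w = 0 := by
    change V.mkQ w = 0
    simpa using hw
  simp [this]

instance fd_span_pair (x y : X) : FiniteDimensional ℂ (Submodule.span ℂ {x, y}) :=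
  FiniteDimensional.span_of_finite ℂ (Set.toFinite _)

lemma sep2 {x y : X} (hx : x ≠ 0) (hy : ∀ a : ℂ, y ≠ a • x) (a b : ℂ) :
    ∃ f : X →L[ℂ] ℂ, f x = a ∧ f y = b := by
  have hy' : y ∉ Submodule.span ℂ {x} := by
    intro h
    obtain ⟨c, hc⟩ := Submodule.mem_span_singleton.1 h
    exact hy c hc.symm
  obtain ⟨f1, h1, h1'⟩ := sep _ hy'
  obtain ⟨f2, h2⟩ := SeparatingDual.exists_eq_one (R := ℂ) hx
  have h1x := h1' x (Submodule.mem_span_singleton_self x)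
  refine ⟨a • f2 + (b - a * f2 y) • f1, ?_, ?_⟩
  · simp [h1x, h2]
  · simp [h1]

lemma coefs {x y : X} (hx : x ≠ 0) (hy : ∀ a : ℂ, y ≠ a • x) {a b a' b' : ℂ}
    (h : a • x + b • y = a' • x + b' • y) : a = a' ∧ b = b' := by
  obtain ⟨f, hf, hf'⟩ := sep2 hx hy 1 0
  obtain ⟨g, hg, hg'⟩ := sep2 hx hy 0 1
  have h1 := congrArg f h
  have h2 := congrArg g h
  simp [hf, hf'] at h1
  simp [hg, hg'] at h2
  exact ⟨h1, h2⟩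

lemma locally_smul {V W : Type*} [AddCommGroup V] [Module ℂ V] [AddCommGroup W] [Module ℂ W]
    (A B : V →ₗ[ℂ] W) (h : ∀ x, ∃ c : ℂ, B x = c • A x) : ∃ c : ℂ, ∀ x, B x = c • A x := by
  by_cases h0 : ∀ x, A x = 0
  · refine ⟨0, fun x => ?_⟩
    obtain ⟨c, hc⟩ := h x
    rw [hc, h0, smul_zero, smul_zero]
  push Not at h0
  obtain ⟨x0, hx0⟩ := h0
  obtain ⟨c, hc⟩ := h x0
  refine ⟨c, fun y => ?_⟩
  by_cases hd : ∃ d : ℂ, A y = d • A x0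
  · obtain ⟨d, hd⟩ := hd
    obtain ⟨e, he⟩ := h (y - d • x0)
    rw [map_sub, map_sub, map_smul, map_smul, hd, sub_self, smul_zero, sub_eq_zero] at he
    rw [he, hc, hd, smul_comm]
  · push Not at hd
    obtain ⟨e, he⟩ := h (y + x0)
    obtain ⟨c', hc'⟩ := h y
    rw [map_add, map_add, hc, hc', smul_add] at he
    have h1 : (c' - e) • A y = (e - c) • A x0 := by
      rw [sub_smul, sub_smul, sub_eq_sub_iff_add_eq_add, he, add_comm]
    have h2 : c' - e = 0 := by
      by_contra hne
      apply hd ((c' - e)⁻¹ * (e - c))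
      rw [mul_smul, ← h1, smul_smul, inv_mul_cancel₀ hne, one_smul]
    rw [h2, zero_smul] at h1
    have h3 : e - c = 0 := (smul_eq_zero.1 h1.symm).resolve_right hx0
    have : c' = c := by linear_combination h2 + h3
    rw [hc', this]

section spec
variable {A : X →L[ℂ] X} {f : X →L[ℂ] ℂ} {x : X}

lemma spec1 (hf : f x = 1) {s : ℂ} (hs : s ^ 2 = f (A (A x))) (hne : f (A x) + s ≠ 0) :
    A x + s • x ∈ KS (jp A (rk f x)) := by
  refine KS_eig hne ?_
  rw [map_add, map_smul, jprk_apply, jprk_apply, hf, ← hs]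
  module

lemma spec2 (hf : f x = 1) (hne : f (A x) ^ 2 ≠ f (A (A x))) :
    x ∈ KS (jp A (rk f x)) ∧ A x ∈ KS (jp A (rk f x)) := by
  obtain ⟨s, hs⟩ := IsAlgClosed.exists_pow_nat_eq (f (A (A x))) (n := 2) (by norm_num)
  have hp : f (A x) + s ≠ 0 := fun h => hne (by
    rw [← hs]; linear_combination (f (A x) - s) * h)
  have hm : f (A x) - s ≠ 0 := fun h => hne (by
    rw [← hs]; linear_combination (f (A x) + s) * h)
  have h1 := spec1 hf hs hp
  have h2 : x ∈ KS (jp A (rk f x)) := by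
    refine KS_tri hm h1 ?_
    rw [jprk_apply, hf]
    module
  refine ⟨h2, ?_⟩
  have := (KS _).sub_mem h1 ((KS _).smul_mem s h2)
  simpa using this

lemma spec3 (hf : f x = 1) {t : ℂ} (ht : f (A x) = t) (hc : f (A (A x)) = t ^ 2) {k : X}
    (hk : k ∈ KS (jp A (rk f x))) : ∃ c : ℂ, k = c • (A x + t • x) := by
  obtain ⟨k1, hk1, rfl⟩ := KS_surj hk
  obtain ⟨k2, hk2, rfl⟩ := KS_surj hk1
  refine ⟨f k2 * t + f (A k2), ?_⟩
  simp only [jprk_apply, map_add, map_smul, hf, ht, hc]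
  module

lemma spec4 (hf : f x = 1) (ht : f (A x) = 0) (hc : f (A (A x)) = 0) {k : X}
    (hk : k ∈ KS (jp A (rk f x))) : k = 0 := by
  obtain ⟨k1, hk1, rfl⟩ := KS_surj hk
  obtain ⟨c, rfl⟩ := spec3 hf ht (by simp [hc]) hk1
  simp [jprk_apply, ht, hc]

lemma spec5 {k : X} (hk : k ∈ KS (jp A (rk f x))) : ∃ a b : ℂ, k = a • x + b • A x := by
  obtain ⟨k1, hk1, rfl⟩ := KS_surj hk
  exact ⟨f (A k1), f k1, by rw [jprk_apply, add_comm]⟩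

lemma exists_good (hx : x ≠ 0) (hA : ∀ a : ℂ, A x ≠ a • x) :
    ∃ f : X →L[ℂ] ℂ, f x = 1 ∧ f (A x) ^ 2 ≠ f (A (A x)) := by
  obtain ⟨f0, h0, h0'⟩ := sep2 hx hA 1 0
  obtain ⟨g, hg, hg'⟩ := sep2 hx hA 0 1
  by_contra hcon
  push Not at hcon
  have e : ∀ t : ℂ, t ^ 2 = f0 (A (A x)) + t * g (A (A x)) := by
    intro t
    have := hcon (f0 + t • g) (by simp [h0, hg])
    simpa [h0', hg'] using this
  have e0 := e 0
  have e1 := e 1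
  have e2 := e (-1)
  have : (2 : ℂ) = 0 := by linear_combination e1 + e2 - 2 * e0
  norm_num at this

end spec

/-- Same test subspaces against all rank one idempotents. -/
def SameTests (A B : X →L[ℂ] X) : Prop :=
  ∀ (x : X) (f : X →L[ℂ] ℂ), f x = 1 → KS (jp A (rk f x)) = KS (jp B (rk f x))

lemma rel_local {A B : X →L[ℂ] X} (h : SameTests A B) (x : X) : ∃ c : ℂ, B x = c • A x := by
  by_cases hx : x = 0
  · exact ⟨0, by simp [hx]⟩
  by_cases hA : ∃ a : ℂ, A x = a • x
  · obtain ⟨a, ha⟩ := hA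
    have hB : ∃ b : ℂ, B x = b • x := by
      by_contra hcon
      push Not at hcon
      obtain ⟨f, hf, hf'⟩ := exists_good hx hcon
      have hm := (spec2 hf hf').2
      rw [← h x f hf] at hm
      obtain ⟨p, q, hpq⟩ := spec5 hm
      apply hcon (p + q * a)
      rw [hpq, ha]
      module
    obtain ⟨b, hb⟩ := hB
    by_cases ha0 : a = 0
    · obtain ⟨f, hf⟩ := SeparatingDual.exists_eq_one (R := ℂ) hx
      by_cases hb0 : b = 0
      · exact ⟨0, by simp [hb, hb0]⟩
      · exfalso
        apply hx
        have hxm : x ∈ KS (jp B (rk f x)) := by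
          refine KS_eig (m := 2 * b) (by simpa using hb0) ?_
          simp only [jprk_apply, hb, map_smul, hf, smul_eq_mul]
          module
        rw [← h x f hf] at hxm
        exact spec4 hf (by simp [ha, ha0]) (by simp [ha, ha0]) hxm
    · refine ⟨b / a, ?_⟩
      rw [hb, ha, smul_smul, div_mul_cancel₀ _ ha0]
  push Not at hA
  obtain ⟨α, β, hαβ⟩ : ∃ α β : ℂ, B x = α • x + β • A x := by
    obtain ⟨f, hf, hf'⟩ := exists_good hx hA
    have hm := (spec2 hf hf').2
    rw [h x f hf] at hm
    obtain ⟨p, q, hpq⟩ := spec5 hm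
    have hq : q ≠ 0 := by
      rintro rfl
      exact hA p (by simpa using hpq)
    refine ⟨-(q⁻¹ * p), q⁻¹, ?_⟩
    rw [hpq, smul_add, smul_smul q⁻¹ q, inv_mul_cancel₀ hq]
    module
  suffices hα : α = 0 from ⟨β, by rw [hαβ, hα]; simp⟩
  have hBind : ∀ s : ℂ, B x + s • x = 0 → α + s = 0 ∧ β = 0 := by
    intro s hs
    have := coefs hx hA (a := α + s) (b := β) (a' := 0) (b' := 0) (by
      rw [← sub_eq_zero, ← hs, hαβ]; module)
    exact this
  by_cases hspan : x ∈ Submodule.span ℂ {A x, A (A x)}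
  · obtain ⟨p, q, hpq⟩ := Submodule.mem_span_pair.1 hspan
    have hq : q ≠ 0 := by
      rintro rfl
      have h1 : p • A x = x := by simpa using hpq
      have hp : p ≠ 0 := by
        rintro rfl
        exact hx (by simpa using h1.symm)
      apply hA p⁻¹
      conv_rhs => rw [← h1]
      rw [smul_smul, inv_mul_cancel₀ hp, one_smul]
    obtain ⟨d, hd⟩ := IsAlgClosed.exists_pow_nat_eq (discrim q p (-1)) (n := 2) (by norm_num)
    obtain ⟨t, ht⟩ := exists_quadratic_eq_zero hq ⟨d, by rw [← hd, sq]⟩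
    have ht0 : t ≠ 0 := by
      rintro rfl
      norm_num at ht
    obtain ⟨f, hf, hft⟩ := sep2 hx hA 1 t
    have hft2 : f (A (A x)) = t ^ 2 := by
      have h1 := congrArg f hpq
      simp only [map_add, map_smul, hf, hft, smul_eq_mul] at h1
      apply mul_left_cancel₀ hq
      linear_combination h1 - ht
    have hAt : A x + t • x ∈ KS (jp A (rk f x)) :=
      spec1 hf (by rw [hft2]) (by rw [hft]; simpa [← two_mul] using ht0)
    have he : f (B x) = α + β * t := by
      rw [hαβ]; simp [hf, hft]
    have hee : f (B x) ^ 2 = f (B (B x)) := by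
      by_contra hcon
      have hm := (spec2 hf hcon).1
      rw [← h x f hf] at hm
      obtain ⟨c, hc⟩ := spec3 hf hft hft2 hm
      have h2 := coefs hx hA (a := 1) (b := 0) (a' := c * t) (b' := c) (by
        rw [one_smul, zero_smul, add_zero]
        conv_lhs => rw [hc]
        module)
      have h3 := h2.1
      rw [← h2.2] at h3
      simp at h3
    by_cases he0 : f (B x) = 0
    · exfalso
      rw [h x f hf] at hAt
      have h1 := spec4 hf he0 (by rw [← hee, he0]; simp) hAt
      apply hA (-t)
      rw [neg_smul]
      exact eq_neg_of_add_eq_zero_left h1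
    · have hm := spec1 hf hee (by simpa [← two_mul] using he0)
      rw [← h x f hf] at hm
      obtain ⟨c, hc⟩ := spec3 hf hft hft2 hm
      have h2 := coefs hx hA (a := α + f (B x)) (b := β) (a' := c * t) (b' := c) (by
        have h3 : (α + f (B x)) • x + β • A x = B x + f (B x) • x := by
          conv_rhs => rw [hαβ]
          simp only [hαβ]
          module
        rw [h3, hc]
        module)
      have h4 := h2.1
      rw [he, ← h2.2] at h4
      linear_combination h4 / 2
  · obtain ⟨f, hf, hf'⟩ := sep _ hspan
    have h1 : f (A x) = 0 := hf' _ (Submodule.subset_span (by simp))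
    have h2 : f (A (A x)) = 0 := hf' _ (Submodule.subset_span (by simp))
    have he : f (B x) = α := by
      rw [hαβ]; simp [hf, h1]
    by_contra hα
    obtain ⟨s, hs⟩ := IsAlgClosed.exists_pow_nat_eq (f (B (B x))) (n := 2) (by norm_num)
    have key : ∀ s : ℂ, s ^ 2 = f (B (B x)) → α + s ≠ 0 → False := by
      intro s hs hne
      have hm := spec1 hf hs (by rwa [he])
      rw [← h x f hf] at hm
      exact hne (hBind s (spec4 hf h1 h2 hm)).1
    by_cases hp : α + s = 0
    · refine key (-s) (by rw [neg_sq, hs]) (fun h5 => hα ?_)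
      linear_combination (hp + h5) / 2
    · exact key s hs hp

/-- The property pinning down rank one operators. -/
def R1 (x : X) (S : X →L[ℂ] X) : Prop :=
  KS (jp S S) = Submodule.span ℂ {x} ∧
    ∀ A : X →L[ℂ] X, ∃ a b : X, KS (jp A S) ≤ Submodule.span ℂ {a, b}

lemma R1_rk {x : X} {f : X →L[ℂ] ℂ} (hf : f x ≠ 0) : R1 x (rk f x) := by
  refine ⟨le_antisymm ?_ ?_, fun A => ⟨x, A x, fun k hk => ?_⟩⟩
  · intro k hk
    obtain ⟨k1, hk1, rfl⟩ := KS_surj hk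
    rw [Submodule.mem_span_singleton]
    refine ⟨2 * f x * f k1, ?_⟩
    simp only [jprk_apply, rk_apply, map_smul, smul_eq_mul]
    module
  · rw [Submodule.span_singleton_le_iff_mem]
    refine KS_eig (m := 2 * f x * f x) (by simpa using hf) ?_
    simp only [jprk_apply, rk_apply, map_smul, smul_eq_mul]
    module
  · obtain ⟨a, b, h⟩ := spec5 hk
    exact Submodule.mem_span_pair.2 ⟨a, b, h.symm⟩

lemma three_in_two {x y z a b : X} (hx : x ≠ 0) (hy : ∀ c : ℂ, y ≠ c • x)
    (hz : z ∉ Submodule.span ℂ {x, y}) (V : Submodule ℂ X) (hV : V ≤ Submodule.span ℂ {a, b})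
    (hxV : x ∈ V) (hyV : y ∈ V) (hzV : z ∈ V) : False := by
  have hle : Submodule.span ℂ {x, y} ≤ Submodule.span ℂ {a, b} := by
    rw [Submodule.span_le]
    rintro w (rfl | rfl)
    · exact hV hxV
    · exact hV hyV
  have hli : LinearIndependent ℂ ![x, y] := by
    rw [LinearIndependent.pair_iff]
    intro s t hst
    exact coefs hx hy (a' := 0) (b' := 0) (by simpa using hst)
  have h2 : Module.finrank ℂ (Submodule.span ℂ {x, y}) = 2 := by
    have := finrank_span_eq_card hli
    have e : Set.range ![x, y] = {x, y} := by
      rw [Matrix.range_cons, Matrix.range_cons, Matrix.range_empty, Set.union_empty]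
      rfl
    rw [e] at this
    rw [this]
    simp
  have h3 : Module.finrank ℂ (Submodule.span ℂ {a, b}) ≤ 2 := by
    classical
    have := finrank_span_finset_le_card (R := ℂ) ({a, b} : Finset X)
    simp only [Finset.coe_insert, Finset.coe_singleton] at this
    exact this.trans Finset.card_le_two
  have heq := Submodule.eq_of_le_of_finrank_le hle (by rw [h2]; exact h3)
  exact hz (heq ▸ hV hzV)

lemma R1_eq (hX : ¬ FiniteDimensional ℂ X) {x : X} (hx : x ≠ 0) {S : X →L[ℂ] X} (h : R1 x S) :
    ∃ f : X →L[ℂ] ℂ, S = rk f x ∧ f x ≠ 0 := by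
  obtain ⟨h1, h2⟩ := h
  have hxK : x ∈ KS (jp S S) := by rw [h1]; exact Submodule.mem_span_singleton_self x
  obtain ⟨l, hl⟩ : ∃ l : ℂ, S x = l • x := by
    have hm := KS_inv (R := S) (fun z => by simp [jp_apply]) hxK
    rw [h1, Submodule.mem_span_singleton] at hm
    obtain ⟨l, hl⟩ := hm
    exact ⟨l, hl.symm⟩
  have hl0 : l ≠ 0 := by
    rintro rfl
    obtain ⟨k, hk, hkx⟩ := KS_surj hxK
    rw [h1, Submodule.mem_span_singleton] at hk
    obtain ⟨c, rfl⟩ := hk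
    apply hx
    rw [← hkx]
    simp [jp_apply, hl]
  have hdep : ∀ y, ∃ c d : ℂ, S y = c • y + d • x := by
    intro y
    by_contra hcon
    push Not at hcon
    have hy : ∀ c : ℂ, y ≠ c • x := by
      rintro c rfl
      apply hcon 0 (c * l)
      rw [map_smul, hl]
      module
    have hz : S y ∉ Submodule.span ℂ {x, y} := by
      intro hm
      obtain ⟨p, q, hpq⟩ := Submodule.mem_span_pair.1 hm
      exact hcon q p (by rw [← hpq, add_comm])
    obtain ⟨g, hg, hg'⟩ := sep _ hz
    have hgx : g x = 0 := hg' x (Submodule.subset_span (by simp))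
    have hgy : g y = 0 := hg' y (Submodule.subset_span (by simp))
    obtain ⟨e, hex, hey⟩ := sep2 hx hy 1 0
    obtain ⟨w, hwx, hwy, hwz⟩ : ∃ w : X →L[ℂ] ℂ, w x = 1 ∧ w y = 0 ∧ w (S y) = 0 :=
      ⟨e - e (S y) • g, by simp [hex, hgx], by simp [hey, hgy], by simp [hg]⟩
    obtain ⟨a, b, hab⟩ := h2 (rk w x + rk g y)
    have hT : ∀ v, jp (rk w x + rk g y) S v =
        w (S v) • x + g (S v) • y + (w v * l) • x + g v • S y := by
      intro v
      simp only [jp_apply, rk_apply, add_apply, map_add, map_smul, hl]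
      module
    have hxm : x ∈ KS (jp (rk w x + rk g y) S) := by
      refine KS_eig (m := 2 * l) (by simpa using hl0) ?_
      simp only [hT, hl, map_smul, hwx, hgx, smul_eq_mul]
      module
    have hym : y ∈ KS (jp (rk w x + rk g y) S) := by
      refine KS_eig (m := 1) one_ne_zero ?_
      simp only [hT, hwy, hwz, hg, hgy]
      module
    have hzm : S y ∈ KS (jp (rk w x + rk g y) S) := by
      refine KS_tri (m := 1) one_ne_zero
        ((KS _).add_mem ((KS _).smul_mem (w (S (S y))) hxm) ((KS _).smul_mem (g (S (S y))) hym)) ?_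
      simp only [hT, hwz, hg]
      module
    exact three_in_two hx hy hz _ hab hxm hym hzm
  obtain ⟨m, hm⟩ := locally_smul (Submodule.span ℂ {x}).mkQ
    ((Submodule.span ℂ {x}).mkQ ∘ₗ (S : X →ₗ[ℂ] X)) (by
      intro y
      obtain ⟨c, d, hcd⟩ := hdep y
      refine ⟨c, ?_⟩
      rw [← map_smul, ← sub_eq_zero, LinearMap.comp_apply, ← map_sub, Submodule.mkQ_apply,
        Submodule.Quotient.mk_eq_zero, Submodule.mem_span_singleton]
      exact ⟨d, by simp [hcd]⟩)
  have hm' : ∀ y, ∃ d : ℂ, S y = m • y + d • x := by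
    intro y
    have h3 := hm y
    rw [← map_smul, ← sub_eq_zero, LinearMap.comp_apply, ← map_sub, Submodule.mkQ_apply,
        Submodule.Quotient.mk_eq_zero, Submodule.mem_span_singleton] at h3
    obtain ⟨d, hd⟩ := h3
    exact ⟨d, by rw [hd]; simp⟩
  have hm0 : m = 0 := by
    by_contra hm0
    obtain ⟨y, hy⟩ : ∃ y, y ∉ Submodule.span ℂ {x} := by
      by_contra hcon
      push Not at hcon
      apply hX
      have htop : Submodule.span ℂ {x} = ⊤ := by
        rw [eq_top_iff]; intro y _; exact hcon y
      have : FiniteDimensional ℂ (⊤ : Submodule ℂ X) := by rw [← htop]; infer_instance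
      exact Module.finite_def.2 ((Submodule.fg_top _).1 (Module.finite_def.1 this))
    obtain ⟨d, hd⟩ := hm' y
    apply hy
    rw [← h1]
    refine KS_tri (m := 2 * m * m) (k := (2 * m * d + 2 * d * l) • x) (by simpa using hm0)
      ((KS _).smul_mem _ hxK) ?_
    simp only [jp_apply, hd, map_add, map_smul, hl]
    module
  obtain ⟨g, hg⟩ := SeparatingDual.exists_eq_one (R := ℂ) hx
  refine ⟨g.comp S, ?_, by simpa [hl, hg] using hl0⟩
  ext y
  obtain ⟨d, hd⟩ := hm' y
  simp [rk_apply, hd, hm0, hg]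

section phi
variable {phi : (X →L[ℂ] X) → (X →L[ℂ] X)}

lemma R1_phi (hsurj : Function.Surjective phi)
    (H : ∀ T S, KS (jp (phi T) (phi S)) = KS (jp T S)) (x : X) (S : X →L[ℂ] X) :
    R1 x (phi S) ↔ R1 x S := by
  constructor
  · rintro ⟨h1, h2⟩
    refine ⟨by rw [← H, h1], fun A => ?_⟩
    rw [← H]
    exact h2 _
  · rintro ⟨h1, h2⟩
    refine ⟨by rw [H, h1], fun A => ?_⟩
    obtain ⟨A, rfl⟩ := hsurj A
    rw [H]
    exact h2 _

lemma phi_rk (hX : ¬ FiniteDimensional ℂ X) (hsurj : Function.Surjective phi)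
    (H : ∀ T S, KS (jp (phi T) (phi S)) = KS (jp T S)) {x : X} {f : X →L[ℂ] ℂ} (hf : f x ≠ 0) :
    ∃ c : ℂ, c ≠ 0 ∧ phi (rk f x) = c • rk f x := by
  have hx : x ≠ 0 := by
    rintro rfl
    simp at hf
  obtain ⟨f', hf', hf'x⟩ := R1_eq hX hx ((R1_phi hsurj H x _).2 (R1_rk hf))
  have hker : ∀ y, f y = 0 → f' y = 0 := by
    intro y hy
    by_contra hF
    have hyind : ∀ c : ℂ, y ≠ c • x := by
      rintro c rfl
      have hc : c = 0 := by simpa [hf] using hy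
      simp [hc] at hF
    have hy0 : y ≠ 0 := by
      rintro rfl
      simp at hF
    obtain ⟨g', hgx, hgy⟩ := sep2 hx hyind 1 1
    obtain ⟨S, hS⟩ := hsurj (rk g' y)
    have hR : R1 y (phi S) := by rw [hS]; exact R1_rk (by simp [hgy])
    obtain ⟨g, rfl, hg⟩ := R1_eq hX hy0 ((R1_phi hsurj H y _).1 hR)
    have hK := H (rk f x) (rk g y)
    rw [hf', hS] at hK
    have hbot : ∀ k ∈ KS (jp (rk f x) (rk g y)), k = 0 := by
      intro k hk
      obtain ⟨k1, hk1, rfl⟩ := KS_surj hk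
      obtain ⟨k2, hk2, rfl⟩ := KS_surj hk1
      simp [jprk_apply, rk_apply, hy]
    obtain ⟨s0, hs0⟩ := IsAlgClosed.exists_pow_nat_eq (f' y * f' x) (n := 2) (by norm_num)
    obtain ⟨s, hs, hne⟩ : ∃ s : ℂ, s ^ 2 = f' y * f' x ∧ f' y + s ≠ 0 := by
      by_cases hp : f' y + s0 = 0
      · refine ⟨-s0, by rw [neg_sq, hs0], fun h5 => hF ?_⟩
        linear_combination (hp + h5) / 2
      · exact ⟨s0, hs0, hp⟩
    have hm : f' y • x + s • y ∈ KS (jp (rk f' x) (rk g' y)) := by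
      refine KS_eig hne ?_
      simp only [jprk_apply, rk_apply, map_add, map_smul, smul_eq_mul, hgx, hgy]
      have h6 : (f' y * f' x) • y = (s ^ 2) • y := by rw [hs]
      refine sub_eq_zero.1 (Eq.trans ?_ (sub_eq_zero.2 h6))
      module
    rw [hK] at hm
    have h7 := coefs hx hyind (a' := 0) (b' := 0) (by simpa using hbot _ hm)
    exact hF h7.1
  refine ⟨f' x / f x, div_ne_zero hf'x hf, ?_⟩
  rw [hf']
  ext v
  have h8 := hker (v - (f v / f x) • x) (by simp [hf])
  rw [map_sub, map_smul, sub_eq_zero] at h8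
  simp only [rk_apply, smul_apply, h8, smul_eq_mul, smul_smul]
  congr 1
  ring

lemma phi_rel (hX : ¬ FiniteDimensional ℂ X) (hsurj : Function.Surjective phi)
    (H : ∀ T S, KS (jp (phi T) (phi S)) = KS (jp T S)) (A : X →L[ℂ] X) : SameTests A (phi A) := by
  intro x f hf
  obtain ⟨c, hc, hcP⟩ := phi_rk hX hsurj H (x := x) (f := f) (by simp [hf])
  rw [← H A (rk f x), hcP]
  have : jp (phi A) (c • rk f x) = c • jp (phi A) (rk f x) := by
    ext v
    simp [jp_apply]
  rw [this, KS_smul hc]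

end phi

end innerRadiusHelpers

theorem main_innerRadius_theorem {X : Type*} [NormedAddCommGroup X] [NormedSpace ℂ X]
    [CompleteSpace X] (hX : ¬ FiniteDimensional ℂ X)
    (phi : (X →L[ℂ] X) → (X →L[ℂ] X)) (hsurj : Function.Surjective phi) :
    (∀ (x : X) (T S : X →L[ℂ] X),
        innerLocalRadius (phi T * phi S + phi S * phi T) x = 0 ↔
          innerLocalRadius (T * S + S * T) x = 0) ↔
      ∃ gamma : (X →L[ℂ] X) → ℂ, (∀ T, gamma T ≠ 0) ∧ ∀ T, phi T = gamma T • T := by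

  have hne : ∀ T S : X →L[ℂ] X, T * S + S * T = jp T S := fun _ _ => rfl
  simp only [hne, radius_iff, not_iff_not]
  constructor
  · intro h
    have H : ∀ T S, KS (jp (phi T) (phi S)) = KS (jp T S) := fun T S => by
      ext x
      exact h x T S
    have key : ∀ T, ∃ c : ℂ, c ≠ 0 ∧ phi T = c • T := by
      intro T
      have hr := phi_rel hX hsurj H T
      obtain ⟨c, hc⟩ := locally_smul (T : X →ₗ[ℂ] X) (phi T : X →ₗ[ℂ] X) (rel_local hr)
      by_cases hc0 : c = 0
      · have hphi : ∀ x, phi T x = 0 := fun x => by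
          have := hc x
          simpa [hc0] using this
        have hT : ∀ x, T x = 0 := fun x => by
          obtain ⟨d, hd⟩ := rel_local (fun x f hf => (hr x f hf).symm) x
          rw [hd, hphi, smul_zero]
        refine ⟨1, one_ne_zero, ?_⟩
        ext x
        simp [hphi, hT]
      · exact ⟨c, hc0, by ext x; exact hc x⟩
    choose gamma h1 h2 using key
    exact ⟨gamma, h1, h2⟩
  · rintro ⟨gamma, h1, h2⟩ x T S
    have : jp (phi T) (phi S) = (gamma T * gamma S) • jp T S := by
      ext v
      simp only [jp_apply, h2, smul_apply, map_smul, smul_add, smul_smul]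
      rw [mul_comm (gamma S)]
    rw [this, KS_smul (mul_ne_zero (h1 T) (h1 S))]
end
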